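/- arXiv:0812.4012 — 15 statements merged into one kernel-verified Lean document; each statement's English description precedes it below -/
import Mathlib

section
/- Let q ≥ 2, n ≥ 2, and α, β ∈ ZMod q with α + β = 0 and β a unit. Let Γ be a vertex-disjoint cycle of length l in B_{n−1}(q) with symbol sequence γ : ZMod l → ZMod q. Then W(Γ) = 0 if and only if there exists a primitive vertex-disjoint cycle of length l in B_n(q), with symbol sequence x : ZMod l → ZMod q, such that α·x_i + β·x_{i+1} = γ_i for all i ∈ ZMod l (i.e., Γ is the image of this cycle under the homomorphism D induced by d(x₁,x₂) = αx₁ + βx₂). -/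
namespace DeBruijn

/-- Vertex `i` of a cycle of length `l` with symbol sequence `c`, as a word of length `n`
in the De Bruijn digraph `B_n(q)`. -/
def cycleVertex (n : ℕ) {q l : ℕ} (c : ZMod l → ZMod q) (i : ZMod l) : Fin n → ZMod q :=
  fun j => c (i + ((j : ℕ) : ZMod l))

/-- A cycle is vertex disjoint if its vertices are pairwise distinct. -/
def VertexDisjoint (n : ℕ) {q l : ℕ} (c : ZMod l → ZMod q) : Prop :=
  Function.Injective (cycleVertex n c)

/-- The weight of a cycle: the sum of its symbols in `ZMod q`. -/
def weight (l : ℕ) {q : ℕ} (c : ZMod l → ZMod q) : ZMod q :=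
  ∑ i ∈ Finset.range l, c ((i : ℕ) : ZMod l)

/-- A cycle is primitive if no vertex of it is a nontrivial translate of another. -/
def Primitive (n : ℕ) {q l : ℕ} (c : ZMod l → ZMod q) : Prop :=
  ∀ i j : ZMod l, ∀ μ : ZMod q,
    (∀ t : Fin n, cycleVertex n c j t = cycleVertex n c i t + μ) → μ = 0

theorem key (q n l : ℕ) (hn : 2 ≤ n) (α β : ZMod q) (hαβ : α + β = 0)
    (γ : ZMod l → ZMod q) (hΓ : VertexDisjoint (n - 1) γ) (x : ZMod l → ZMod q)
    (hx : ∀ i : ZMod l, α * x i + β * x (i + 1) = γ i) (i j : ZMod l) (μ : ZMod q)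
    (h : ∀ t : Fin n, cycleVertex n x j t = cycleVertex n x i t + μ) : j = i := by
  apply hΓ
  funext t
  have h0 := h ⟨t, by omega⟩
  have h1 := h ⟨t + 1, by omega⟩
  simp only [cycleVertex, Nat.cast_add, Nat.cast_one, ← add_assoc] at h0 h1 ⊢
  rw [← hx, ← hx, h0, h1]
  linear_combination μ * hαβ

/-- For `α + β = 0` with `β` a unit, a vertex-disjoint cycle `Γ` of length `l`
in `B_{n-1}(q)` has weight `0` iff it is the image, under the homomorphism induced by
`d(x₁,x₂) = αx₁ + βx₂`, of a primitive vertex-disjoint cycle of length `l` in `B_n(q)`. -/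
theorem stmt0 (q n l : ℕ) (hq : 2 ≤ q) (hn : 2 ≤ n) (hl : 0 < l)
    (α β : ZMod q) (hαβ : α + β = 0) (hβ : IsUnit β)
    (γ : ZMod l → ZMod q) (hΓ : VertexDisjoint (n - 1) γ) :
    weight l γ = 0 ↔
      ∃ x : ZMod l → ZMod q,
        VertexDisjoint n x ∧ Primitive n x ∧
        ∀ i : ZMod l, α * x i + β * x (i + 1) = γ i := by
  have : NeZero l := ⟨hl.ne'⟩
  have hα : α = -β := by linear_combination hαβ
  constructor
  · intro hw
    obtain ⟨b, hb⟩ := hβ.exists_right_inv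
    have hx : ∀ i : ZMod l, α * (fun i : ZMod l => b * ∑ k ∈ Finset.range i.val, γ (k : ZMod l)) i
        + β * (fun i : ZMod l => b * ∑ k ∈ Finset.range i.val, γ (k : ZMod l)) (i + 1) = γ i := by
      intro i
      have hv : (i + 1).val = (i.val + 1) % l := by
        rw [← ZMod.val_natCast]; simp
      have hS : ∑ k ∈ Finset.range (i + 1).val, γ (k : ZMod l)
          = ∑ k ∈ Finset.range i.val, γ (k : ZMod l) + γ i := by
        have h2 : ∑ k ∈ Finset.range (i.val + 1), γ (k : ZMod l)
          = ∑ k ∈ Finset.range i.val, γ (k : ZMod l) + γ i := by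
          rw [Finset.sum_range_succ]; simp
        rw [← h2, hv]
        rcases Nat.lt_or_ge (i.val + 1) l with h | h
        · rw [Nat.mod_eq_of_lt h]
        · have h3 : i.val + 1 = l := by have := ZMod.val_lt i; omega
          rw [h3, Nat.mod_self]
          simpa [weight] using hw.symm
      simp only [hS, hα]
      linear_combination γ i * hb
    refine ⟨_, ?_, ?_, hx⟩
    · intro i j h
      exact key q n l hn α β hαβ γ hΓ _ hx j i 0 (fun t => by rw [h, add_zero])
    · intro i j μ h
      have hij := key q n l hn α β hαβ γ hΓ _ hx i j μ h
      subst hij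
      simpa using h ⟨0, by omega⟩
  · rintro ⟨x, -, -, hx⟩
    have h : ∀ m : ℕ, ∑ k ∈ Finset.range m, γ (k : ZMod l) = β * (x (m : ZMod l) - x 0) := by
      intro m
      induction m with
      | zero => simp
      | succ m ih =>
        rw [Finset.sum_range_succ, ih, ← hx, hα]
        push_cast
        ring
    simp [weight, h l]

end DeBruijn
end

section
/- Let q ≥ 2, n ≥ 2, α, β ∈ ZMod q with α + β = 0 and β a unit, and let Γ be a vertex-disjoint cycle of length l in B_{n−1}(q) with symbol sequence γ : ZMod l → ZMod q. Fix λ ∈ ZMod q with λ ≠ 0 and set r = q / gcd(λ̄, q), where λ̄ ∈ {1,…,q−1} is the integer representative of λ. Then W(Γ) = λ if and only if there exists a word x_1,…,x_l over ZMod q such that the cyclic symbol sequence X of length r·l given by X_{j·l + i} = x_i + j·β⁻¹·λ (for i = 1,…,l and j = 0,…,r−1) defines a vertex-disjoint cycle C in B_n(q) satisfying α·X_p + β·X_{p+1} = γ_{p mod l} for all p ∈ ZMod(r·l) (i.e., the image of C under the homomorphism induced by d(x₁,x₂) = αx₁ + βx₂ is the r-fold traversal of Γ). -/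
namespace DeBruijn

/-- For `α + β = 0` with `β` a unit, a vertex-disjoint cycle `Γ` of length `l`
in `B_{n-1}(q)` has weight `λ ≠ 0` iff it is the image (traversed `r` times,
`r = q / gcd(λ̄, q)`) of a vertex-disjoint cycle of length `r·l` in `B_n(q)` obtained by
concatenating a word `x` with its successive translates by `β⁻¹λ`. -/
theorem stmt1 (q n l : ℕ) (hq : 2 ≤ q) (hn : 2 ≤ n) (hl : 0 < l)
    (α β : ZMod q) (hαβ : α + β = 0) (hβ : IsUnit β)
    (γ : ZMod l → ZMod q) (hΓ : VertexDisjoint (n - 1) γ)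
    (lam : ZMod q) (hlam : lam ≠ 0) (r : ℕ) (hr : r = q / Nat.gcd lam.val q) :
    weight l γ = lam ↔
      ∃ (x : ZMod l → ZMod q) (X : ZMod (r * l) → ZMod q),
        (∀ j : ℕ, j < r → ∀ i : ℕ, i < l →
          X ((j * l + i : ℕ) : ZMod (r * l)) =
            x ((i : ℕ) : ZMod l) + (j : ZMod q) * (β⁻¹ * lam)) ∧
        VertexDisjoint n X ∧
        (∀ p : ZMod (r * l), α * X p + β * X (p + 1) =
          γ (ZMod.castHom (dvd_mul_left l r) (ZMod l) p)) := by
  have hq0 : q ≠ 0 := by omega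
  haveI : NeZero q := ⟨hq0⟩
  haveI : NeZero l := ⟨hl.ne'⟩
  have hord : addOrderOf lam = r := by
    have h := ZMod.addOrderOf_coe lam.val hq0
    rw [ZMod.natCast_zmod_val] at h
    rw [h, hr, Nat.gcd_comm]
  have hrdvd : ∀ k : ℕ, (k : ZMod q) * lam = 0 ↔ r ∣ k := by
    intro k
    rw [← hord, addOrderOf_dvd_iff_nsmul_eq_zero, nsmul_eq_mul]
  have hr0 : 0 < r := by
    rw [← hord]; exact addOrderOf_pos lam
  have hr1 : 1 < r := by
    rcases Nat.lt_or_ge 1 r with h | h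
    · exact h
    · exfalso
      have h1 : r = 1 := by omega
      apply hlam
      have := (hrdvd 1).2 (by rw [h1])
      simpa using this
  have hrl : 0 < r * l := Nat.mul_pos hr0 hl
  haveI : NeZero (r * l) := ⟨hrl.ne'⟩
  have hα : α = -β := eq_neg_of_add_eq_zero_left hαβ
  have hbb : β * β⁻¹ = 1 := ZMod.mul_inv_of_unit β hβ
  constructor
  · intro hW
    set S : ℕ → ZMod q := fun m => β⁻¹ * ∑ i ∈ Finset.range m, γ (i : ZMod l) with hS
    have hSs : ∀ m, S (m + 1) = S m + β⁻¹ * γ (m : ZMod l) := by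
      intro m
      simp only [hS, Finset.sum_range_succ, mul_add]
    have hSl : ∀ m, S (m + l) = S m + β⁻¹ * lam := by
      intro m
      induction m with
      | zero =>
        have : S 0 = 0 := by simp [hS]
        rw [this, zero_add, zero_add, ← hW]
        rfl
      | succ m ih =>
        rw [show m + 1 + l = (m + l) + 1 by ring, hSs, ih, hSs]
        simp
        ring
    have hSk : ∀ k m, S (m + k * l) = S m + (k : ZMod q) * (β⁻¹ * lam) := by
      intro k m
      induction k with
      | zero => simp
      | succ k ih =>
        rw [show m + (k + 1) * l = (m + k * l) + l by ring, hSl, ih]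
        push_cast
        ring
    have hper : Function.Periodic S (r * l) := by
      intro m
      rw [hSk]
      have := (hrdvd r).2 dvd_rfl
      linear_combination β⁻¹ * this
    have hX : ∀ m : ℕ, S ((m : ZMod (r * l)).val) = S m := by
      intro m
      rw [ZMod.val_natCast, hper.map_mod_nat]
    have hstep : ∀ p : ZMod (r * l), α * S p.val + β * S (p + 1).val =
          γ (ZMod.castHom (dvd_mul_left l r) (ZMod l) p) := by
      intro p
      obtain ⟨a, rfl⟩ : ∃ a : ℕ, (a : ZMod (r * l)) = p := ⟨p.val, ZMod.natCast_zmod_val p⟩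
      have h1 : ((a : ZMod (r * l)) + 1) = ((a + 1 : ℕ) : ZMod (r * l)) := by push_cast; rfl
      rw [h1, hX, hX, hSs, map_natCast, hα]
      linear_combination γ (a : ZMod l) * hbb
    refine ⟨fun i => S i.val, fun p => S p.val, ?_, ?_, hstep⟩
    · intro j hj i hi
      show S _ = S _ + _
      rw [hX, ZMod.val_natCast, Nat.mod_eq_of_lt hi, add_comm (j * l) i, hSk]
    · have key : ∀ a b : ℕ, a ≤ b → cycleVertex n (fun p : ZMod (r * l) => S p.val) a =
          cycleVertex n (fun p : ZMod (r * l) => S p.val) b →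
          (a : ZMod (r * l)) = (b : ZMod (r * l)) := by
        intro a b hab h
        have hv : ∀ t : ℕ, t < n → S (a + t) = S (b + t) := by
          intro t ht
          have h2 := congrFun h ⟨t, ht⟩
          simp only [cycleVertex] at h2
          rw [← Nat.cast_add, ← Nat.cast_add, hX, hX] at h2
          exact h2
        have hg : (a : ZMod l) = (b : ZMod l) := by
          apply hΓ
          funext t
          simp only [cycleVertex]
          have h0 := hv t (by omega)
          have h1 := hv (t + 1) (by omega)
          rw [← add_assoc, ← add_assoc, hSs, hSs, h0] at h1
          have h3 := add_left_cancel h1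
          push_cast at h3
          linear_combination β * h3 - (γ (a + (t : ℕ)) - γ (b + (t : ℕ))) * hbb
        have hmod := (ZMod.natCast_eq_natCast_iff a b l).1 hg
        obtain ⟨k, hk⟩ := (Nat.modEq_iff_dvd' hab).1 hmod
        have hb : b = a + k * l := by rw [mul_comm k l]; omega
        have h0 := hv 0 (by omega)
        rw [add_zero, add_zero, hb, hSk] at h0
        have hz : (k : ZMod q) * (β⁻¹ * lam) = 0 := by
          linear_combination -h0
        have hd : r ∣ k := by
          rw [← hrdvd]
          linear_combination β * hz - (k : ZMod q) * lam * hbb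
        obtain ⟨c, rfl⟩ := hd
        rw [hb, show a + r * c * l = a + (r * l) * c by ring, Nat.cast_add,
          Nat.cast_mul (r * l) c, ZMod.natCast_self]
        simp
      intro p p' h
      rw [← ZMod.natCast_zmod_val p, ← ZMod.natCast_zmod_val p'] at h ⊢
      rcases le_total p.val p'.val with hle | hle
      · exact key _ _ hle h
      · exact (key _ _ hle h.symm).symm
  · rintro ⟨x, X, h1, -, h3⟩
    have ha := h1 0 hr0 0 hl
    have hb := h1 1 hr1 0 hl
    have hsum : ∀ m : ℕ, ∑ i ∈ Finset.range m, γ (i : ZMod l) =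
        β * (X (m : ZMod (r * l)) - X ((0 : ℕ) : ZMod (r * l))) := by
      intro m
      induction m with
      | zero => simp
      | succ m ih =>
        have h4 := h3 (m : ZMod (r * l))
        rw [map_natCast] at h4
        rw [Finset.sum_range_succ, ih, ← h4, hα]
        push_cast
        ring
    unfold weight
    rw [hsum l]
    simp only [zero_mul, one_mul, add_zero, Nat.cast_zero, Nat.cast_one] at ha hb
    rw [hb, Nat.cast_zero, ha]
    linear_combination lam * hbb

end DeBruijn
end

section
/- Let q ≥ 2, n ≥ 2, α, β ∈ ZMod q with α + β = 0 and β a unit, and let γ ∈ ZMod q be a unit. Set μ = β⁻¹·γ and let θ ∈ (ZMod q)^n be the word with θ_i = (i−1)·μ for i = 1,…,n. Then the set of words x ∈ (ZMod q)^n satisfying α·x_i + β·x_{i+1} = γ for all i = 1,…,n−1 (the preimage of the self-loop at the constant word (γ,…,γ) of length n−1 under the homomorphism induced by d(x₁,x₂) = αx₁ + βx₂) is exactly {θ + c : c ∈ ZMod q}; moreover for each c the word θ + c + μ is a successor of θ + c in B_n(q), so these q words form a single vertex-disjoint cycle of length q in B_n(q). -/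
namespace DeBruijn

/-- The preimage of the self-loop at the constant word `(γ,…,γ)` of length
`n-1` under the homomorphism induced by `d(x₁,x₂) = αx₁ + βx₂` (with `α + β = 0`, `β` a unit,
`γ` a unit) is exactly the set of translates `θ + c` of the alternating word
`θ_i = i·μ`, `μ = β⁻¹γ`; each `θ + c + μ` is a successor of `θ + c`, and these `q` words form
a single vertex-disjoint cycle of length `q` in `B_n(q)`. -/
theorem stmt2 (q n : ℕ) (hq : 2 ≤ q) (hn : 2 ≤ n)
    (α β γ : ZMod q) (hαβ : α + β = 0) (hβ : IsUnit β) (hγ : IsUnit γ)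
    (μ : ZMod q) (hμ : μ = β⁻¹ * γ)
    (θ : Fin n → ZMod q) (hθ : ∀ i : Fin n, θ i = ((i : ℕ) : ZMod q) * μ) :
    ({x : Fin n → ZMod q | ∀ i : ℕ, (hi : i + 1 < n) →
        α * x ⟨i, by omega⟩ + β * x ⟨i + 1, hi⟩ = γ} =
      {y : Fin n → ZMod q | ∃ c : ZMod q, y = fun i => θ i + c}) ∧
    (∀ c : ZMod q, ∀ i : ℕ, (hi : i + 1 < n) →
      (θ ⟨i, by omega⟩ + c) + μ = θ ⟨i + 1, hi⟩ + c) ∧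
    VertexDisjoint n (fun t : ZMod q => t * μ) ∧
    Set.range (cycleVertex n (fun t : ZMod q => t * μ)) =
      {y : Fin n → ZMod q | ∃ c : ZMod q, y = fun i => θ i + c} := by
  have hb : β * β⁻¹ = 1 := by
    have := ZMod.mul_inv_of_unit β hβ
    exact this
  have hbm : β * μ = γ := by rw [hμ, ← mul_assoc, hb, one_mul]
  have hmu : IsUnit μ := by
    rw [← hbm] at hγ
    exact isUnit_of_mul_isUnit_right hγ
  have hα : α = -β := eq_neg_of_add_eq_zero_left hαβ
  refine ⟨?_, ?_, ?_, ?_⟩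
  · ext x
    simp only [Set.mem_setOf_eq]
    constructor
    · intro h
      refine ⟨x ⟨0, by omega⟩, ?_⟩
      have key : ∀ i : ℕ, ∀ hi : i < n, x ⟨i, hi⟩ = (i : ZMod q) * μ + x ⟨0, by omega⟩ := by
        intro i
        induction i with
        | zero => intro hi; simp
        | succ k ih =>
          intro hi
          have h1 := h k hi
          have h2 := ih (by omega)
          have h3 : β * x ⟨k + 1, hi⟩ = β * (x ⟨k, by omega⟩ + μ) := by
            rw [hα] at h1
            linear_combination h1 - hbm
          have h4 := hβ.mul_left_cancel h3
          rw [h4, h2]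
          push_cast
          ring
      funext i
      rw [hθ i]
      exact key i.1 i.2
    · rintro ⟨c, rfl⟩ i hi
      simp only [hθ, hα]
      push_cast
      linear_combination hbm
  · intro c i hi
    simp only [hθ]
    push_cast
    ring
  · intro i j hij
    have h := congrFun hij ⟨0, by omega⟩
    simp only [cycleVertex, Nat.cast_zero, add_zero] at h
    exact hmu.mul_right_cancel h
  · ext y
    simp only [Set.mem_range, Set.mem_setOf_eq]
    constructor
    · rintro ⟨t, rfl⟩
      refine ⟨t * μ, ?_⟩
      funext i
      simp only [cycleVertex, hθ]
      ring
    · rintro ⟨c, rfl⟩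
      obtain ⟨v, hv⟩ := hmu.exists_left_inv
      refine ⟨c * v, ?_⟩
      funext i
      simp only [cycleVertex, hθ]
      linear_combination c * hv

end DeBruijn
end

section
/- Let q ≥ 2, n ≥ 1 and k ≥ 0. A map D : (ZMod q)^{n+k} → (ZMod q)^n is a graph homomorphism from B_{n+k}(q) to B_n(q) — that is, for every edge (x; y) of B_{n+k}(q), the pair (D(x); D(y)) is an edge of B_n(q) — if and only if there exists a function d : (ZMod q)^{k+1} → ZMod q such that D(x)_i = d(x_i, x_{i+1}, …, x_{i+k}) for all x ∈ (ZMod q)^{n+k} and all i = 1,…,n. -/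
namespace DeBruijn

/-- The edge relation of the De Bruijn digraph `B_m(q)` on words of length `m`:
there is an edge from `x` to `y` iff `y i = x (i+1)` for `i = 0, …, m-2`. -/
def IsEdge {q m : ℕ} (x y : Fin m → ZMod q) : Prop :=
  ∀ i : ℕ, (hi : i + 1 < m) → y ⟨i, by omega⟩ = x ⟨i + 1, hi⟩

/-- Window of length `m` at position `a`. -/
def win {q : ℕ} (m : ℕ) (s : ℤ → ZMod q) (a : ℤ) : Fin m → ZMod q :=
  fun j => s (a + ((j : ℕ) : ℤ))

theorem win_edge {q m : ℕ} (s : ℤ → ZMod q) (a : ℤ) :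
    IsEdge (win m s a) (win m s (a + 1)) := by
  intro i hi
  simp only [win]
  congr 1
  push_cast
  ring

theorem win_shift {q n k : ℕ} (D : (Fin (n + k) → ZMod q) → Fin n → ZMod q)
    (h : ∀ x y : Fin (n + k) → ZMod q, IsEdge x y → IsEdge (D x) (D y))
    (s : ℤ → ZMod q) (i : ℕ) : ∀ (a : ℤ) (hi : i < n),
    D (win (n + k) s a) ⟨i, hi⟩ = D (win (n + k) s (a + i)) ⟨0, by omega⟩ := by
  induction i with
  | zero => intro a hi; simp
  | succ i ih =>
    intro a hi
    rw [← h _ _ (win_edge s a) i hi, ih (a + 1) (by omega)]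
    have : a + 1 + (i : ℤ) = a + ((i + 1 : ℕ) : ℤ) := by push_cast; ring
    rw [this]

/-- A map `D : B_{n+k}(q) → B_n(q)` is a graph homomorphism iff it is the
sliding-window map of some function `d` of `k+1` variables. -/
theorem stmt3 (q n k : ℕ) (hq : 2 ≤ q) (hn : 1 ≤ n)
    (D : (Fin (n + k) → ZMod q) → Fin n → ZMod q) :
    (∀ x y : Fin (n + k) → ZMod q, IsEdge x y → IsEdge (D x) (D y)) ↔
    ∃ d : (Fin (k + 1) → ZMod q) → ZMod q,
      ∀ (x : Fin (n + k) → ZMod q) (i : Fin n),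
        D x i = d (fun j => x ⟨(i : ℕ) + (j : ℕ), by have := i.isLt; have := j.isLt; omega⟩) := by
  constructor
  · intro h
    refine ⟨fun u => D (fun j => if hj : (j : ℕ) < k + 1 then u ⟨j, hj⟩ else 0) ⟨0, by omega⟩, ?_⟩
    rintro x ⟨i, hi⟩
    let s : ℤ → ZMod q := fun m =>
      if hm : 0 ≤ m ∧ m.toNat < n + k then x ⟨m.toNat, hm.2⟩ else 0
    let s' : ℤ → ZMod q := fun m => if m ≤ i + k then s m else 0
    have hx : x = win (n + k) s 0 := by
      funext j
      simp [win, s]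
    have e1 : D x ⟨i, hi⟩ = D (win (n + k) s i) ⟨0, by omega⟩ := by
      have := win_shift D h s i 0 hi
      rw [← hx, zero_add] at this
      exact this
    have key : ∀ t : ℤ → ZMod q, D (win (n + k) t i) ⟨0, by omega⟩ =
        D (win (n + k) t ((i : ℤ) - ((n - 1 : ℕ) : ℤ))) ⟨n - 1, by omega⟩ := by
      intro t
      rw [win_shift D h t (n - 1) _ (by omega), sub_add_cancel]
    have e2 : win (n + k) s ((i : ℤ) - ((n - 1 : ℕ) : ℤ)) =
        win (n + k) s' ((i : ℤ) - ((n - 1 : ℕ) : ℤ)) := by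
      funext j
      have := j.isLt
      simp only [win, s']
      rw [if_pos (by omega)]
    rw [e1, key, e2, ← key]
    congr 1
    congr 1
    funext j
    have := j.isLt
    simp only [win, s']
    by_cases hj : (j : ℕ) < k + 1
    · rw [if_pos (by omega), dif_pos hj]
      simp only [s]
      rw [dif_pos (by omega)]
      congr 1
    · rw [if_neg (by omega), dif_neg hj]
  · rintro ⟨d, hd⟩ x y hxy i hi
    rw [hd, hd]
    congr 1
    funext j
    have := j.isLt
    have := hxy (i + j) (by omega)
    simp only
    rw [this]
    congr 1
    ext
    simp only
    omega

end DeBruijn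
end

section
/- Let q ≥ 2, n ≥ 1, k ≥ 1 and d : (ZMod q)^{k+1} → ZMod q. The induced sliding-window homomorphism D_{n,k} from B_{n+k}(q) to B_n(q) has property (D) if and only if for every fixed (x_2,…,x_k) ∈ (ZMod q)^{k−1}: (i) for each fixed x_{k+1} the map x_1 ↦ d(x_1,…,x_{k+1}) is a bijection of ZMod q, and (ii) for each fixed x_1 the map x_{k+1} ↦ d(x_1,…,x_{k+1}) is a bijection of ZMod q (i.e., (x_1, x_{k+1}) ↦ d(x_1,…,x_{k+1}) defines a Latin square for each fixed middle block). -/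
namespace DeBruijn

/-- A lift (with seed `w`) of a cycle of length `l` in `B_n(q)` through the sliding-window
homomorphism induced by `d` : a string of length `l + n - 1 + k` whose prefix of size `k`
is `w` and whose `d`-windows spell out the symbol sequence `c` (cyclically). -/
def IsLift (n : ℕ) {q k l : ℕ} (d : (Fin (k + 1) → ZMod q) → ZMod q)
    (c : ZMod l → ZMod q) (w : Fin k → ZMod q)
    (x : Fin (l + n - 1 + k) → ZMod q) : Prop :=
  (∀ j : Fin k, x ⟨j, by have := j.isLt; omega⟩ = w j) ∧
  (∀ j : ℕ, (hj : j < l + n - 1) →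
    d (fun t => x ⟨j + t, by have := t.isLt; omega⟩) = c ((j : ℕ) : ZMod l))

/-- The `j`-th vertex (a word of length `n + k`) of a lift `x`. -/
def liftVertex (n k : ℕ) {q l : ℕ} (x : Fin (l + n - 1 + k) → ZMod q) (j : Fin l) :
    Fin (n + k) → ZMod q :=
  fun t => x ⟨j + t, by have := j.isLt; have := t.isLt; omega⟩

/-- Property (D): for every vertex-disjoint cycle in `B_n(q)` and every seed there is exactly
one lift, and the vertices of all these lifts (over all seeds) are pairwise distinct. -/
def PropertyD (q n k : ℕ) (d : (Fin (k + 1) → ZMod q) → ZMod q) : Prop :=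
  ∀ l : ℕ, 0 < l → ∀ c : ZMod l → ZMod q, VertexDisjoint n c →
    (∀ w : Fin k → ZMod q, ∃! x : Fin (l + n - 1 + k) → ZMod q, IsLift n d c w x) ∧
    (∀ w w' : Fin k → ZMod q, ∀ x x' : Fin (l + n - 1 + k) → ZMod q,
      IsLift n d c w x → IsLift n d c w' x' →
      ∀ j j' : Fin l, liftVertex n k x j = liftVertex n k x' j' → w = w' ∧ j = j')

def liftSeq {α : Type} (k : ℕ) (w : Fin k → α) (s : (Fin k → α) → ℕ → α) (i : ℕ) : α :=
  if h : i < k then w ⟨i, h⟩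
  else s (fun t => liftSeq k w s (i - k + t)) (i - k)
termination_by i
decreasing_by have := t.isLt; omega

lemma snoc_inj {q k : ℕ} {d : (Fin (k + 1) → ZMod q) → ZMod q}
    (h : ∀ m : Fin k → ZMod q, Function.Bijective fun a => d (Fin.snoc m a))
    (f g : Fin (k + 1) → ZMod q) (hfg : ∀ t : Fin k, f t.castSucc = g t.castSucc)
    (hd : d f = d g) : f (Fin.last k) = g (Fin.last k) := by
  have e : Fin.init f = Fin.init g := funext hfg
  apply (h (Fin.init f)).1
  show d (Fin.snoc (Fin.init f) (f (Fin.last k))) = d (Fin.snoc (Fin.init f) (g (Fin.last k)))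
  rw [Fin.snoc_init_self, e, Fin.snoc_init_self, hd]

lemma cons_inj {q k : ℕ} {d : (Fin (k + 1) → ZMod q) → ZMod q}
    (h : ∀ m : Fin k → ZMod q, Function.Bijective fun a => d (Fin.cons a m))
    (f g : Fin (k + 1) → ZMod q) (hfg : ∀ t : Fin k, f t.succ = g t.succ)
    (hd : d f = d g) : f 0 = g 0 := by
  have e : Fin.tail f = Fin.tail g := funext hfg
  apply (h (Fin.tail f)).1
  show d (Fin.cons (f 0) (Fin.tail f)) = d (Fin.cons (g 0) (Fin.tail f))
  rw [Fin.cons_self_tail, e, Fin.cons_self_tail, hd]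

lemma lift_unique {q n k l : ℕ} {d : (Fin (k + 1) → ZMod q) → ZMod q}
    (h : ∀ m : Fin k → ZMod q, Function.Bijective fun a => d (Fin.snoc m a))
    {c : ZMod l → ZMod q} {w w' : Fin k → ZMod q} {x x' : Fin (l + n - 1 + k) → ZMod q}
    (hx : IsLift n d c w x) (hx' : IsLift n d c w' x') (p : ℕ)
    (hp : ∀ i (hi : i < l + n - 1 + k), p ≤ i → i < p + k → x ⟨i, hi⟩ = x' ⟨i, hi⟩) :
    ∀ i (hi : i < l + n - 1 + k), p ≤ i → x ⟨i, hi⟩ = x' ⟨i, hi⟩ := by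
  intro i
  induction i using Nat.strong_induction_on with
  | _ i ih =>
    intro hi hpi
    by_cases hlt : i < p + k
    · exact hp i hi hpi hlt
    · have h1 := hx.2 (i - k) (by omega)
      have h2 := hx'.2 (i - k) (by omega)
      have := snoc_inj h _ _ (fun t => by
        have := t.isLt
        exact ih (i - k + t) (by omega) (by omega) (by omega)) (h1.trans h2.symm)
      have e : i - k + k = i := by omega
      simpa [e] using this

lemma lift_back {q n k l : ℕ} {d : (Fin (k + 1) → ZMod q) → ZMod q}
    (h : ∀ m : Fin k → ZMod q, Function.Bijective fun a => d (Fin.cons a m))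
    {c : ZMod l → ZMod q} {w w' : Fin k → ZMod q} {x x' : Fin (l + n - 1 + k) → ZMod q}
    (hx : IsLift n d c w x) (hx' : IsLift n d c w' x') (p : ℕ) (hpl : p + k ≤ l + n - 1 + k)
    (hp : ∀ i (hi : i < l + n - 1 + k), p ≤ i → i < p + k → x ⟨i, hi⟩ = x' ⟨i, hi⟩) :
    ∀ i (hi : i < l + n - 1 + k), i < p + k → x ⟨i, hi⟩ = x' ⟨i, hi⟩ := by
  induction p with
  | zero => intro i hi hik; exact hp i hi (Nat.zero_le _) hik
  | succ p ih =>
    have key : ∀ i (hi : i < l + n - 1 + k), p ≤ i → i < p + k →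
        x ⟨i, hi⟩ = x' ⟨i, hi⟩ := by
      intro i hi h1 h2
      by_cases hip : i = p
      · subst hip
        have h1 := hx.2 i (by omega)
        have h2 := hx'.2 i (by omega)
        have := cons_inj h _ _ (fun t => by
          have := t.isLt
          exact hp (i + (t + 1)) (by omega) (by omega) (by omega)) (h1.trans h2.symm)
        simpa using this
      · exact hp i hi (by omega) (by omega)
    intro i hi hik
    by_cases hh : i < p + k
    · exact ih (by omega) key i hi hh
    · by_cases hk : p + 1 ≤ i
      · exact hp i hi hk hik
      · have : k = 0 ∧ i = p := by omega
        obtain ⟨rfl, rfl⟩ := this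
        have h1 := hx.2 i (by omega)
        have h2 := hx'.2 i (by omega)
        have := cons_inj h _ _ (fun t => t.elim0) (h1.trans h2.symm)
        simpa using this

lemma lift_exists {q n k l : ℕ} {d : (Fin (k + 1) → ZMod q) → ZMod q}
    (h : ∀ m : Fin k → ZMod q, Function.Bijective fun a => d (Fin.snoc m a))
    (c : ZMod l → ZMod q) (w : Fin k → ZMod q) :
    ∃ x : Fin (l + n - 1 + k) → ZMod q, IsLift n d c w x := by
  choose s hs using fun m => (h m).2
  let y := liftSeq k w (fun m i => s m (c ((i : ℕ) : ZMod l)))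
  refine ⟨fun i => y i, ?_, ?_⟩
  · intro j
    show liftSeq _ _ _ _ = _
    rw [liftSeq]
    simp
  · intro j hj
    have : (fun t : Fin (k + 1) => y (j + t)) =
        Fin.snoc (fun t : Fin k => y (j + t)) (s (fun t : Fin k => y (j + t)) (c (j : ZMod l))) := by
      funext t
      refine Fin.lastCases ?_ (fun t => ?_) t
      · rw [Fin.snoc_last]
        show liftSeq _ _ _ _ = _
        rw [liftSeq]
        simp [y]
      · rw [Fin.snoc_castSucc]; simp
    show d (fun t : Fin (k + 1) => y (j + t)) = _
    rw [this]
    exact hs _ _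

lemma fwd {q n k : ℕ} (hq : 2 ≤ q) (hn : 1 ≤ n) (hk : 1 ≤ k)
    (d : (Fin (k + 1) → ZMod q) → ZMod q) (H : PropertyD q n k d) :
    (∀ m : Fin k → ZMod q, Function.Bijective fun a => d (Fin.cons a m)) ∧
       (∀ m : Fin k → ZMod q, Function.Bijective fun a => d (Fin.snoc m a)) := by
  haveI : NeZero q := ⟨by omega⟩
  haveI : Fact (1 < q) := ⟨by omega⟩
  have hs : ∀ m : Fin k → ZMod q, Function.Bijective fun a => d (Fin.snoc m a) := by
    intro m
    apply Function.Surjective.bijective_of_finite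
    intro b
    obtain ⟨x, hx, -⟩ := (H 1 one_pos (fun _ => b)
      (fun i j _ => Subsingleton.elim (α := Fin 1) i j)).1 m
    refine ⟨x ⟨k, by omega⟩, ?_⟩
    have h0 := hx.2 0 (by omega)
    refine Eq.trans ?_ h0
    show d _ = d _
    congr 1
    funext t
    refine Fin.lastCases ?_ (fun t => ?_) t
    · simp
    · rw [Fin.snoc_castSucc, ← hx.1 t]; simp
  refine ⟨fun m => ?_, hs⟩
  apply Function.Injective.bijective_of_finite
  intro a a' haa
  replace haa : d (Fin.cons a m) = d (Fin.cons a' m) := haa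
  obtain ⟨e, he⟩ := exists_ne (d (Fin.cons a m))
  let c : ZMod 2 → ZMod q := fun i => if i = 0 then d (Fin.cons a m) else e
  have hc : VertexDisjoint n c := by
    intro i j hij
    have := congrFun hij ⟨0, by omega⟩
    simp only [cycleVertex, Nat.cast_zero, add_zero, c] at this
    have two : ∀ i : ZMod 2, i = 0 ∨ i = 1 := by decide
    have h10 : (1 : ZMod 2) ≠ 0 := by decide
    rcases two i with rfl | rfl <;> rcases two j with rfl | rfl <;> simp_all
  obtain ⟨h1, h2⟩ := H 2 two_pos c hc
  have key : ∀ b, d (Fin.cons b m) = d (Fin.cons a m) →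
      ∀ x, IsLift n d c (Fin.init (Fin.cons b m : Fin (k + 1) → ZMod q)) x → ∀ i : Fin k,
      x ⟨i + 1, by have := i.isLt; omega⟩ = m i := by
    intro b hb x hx i
    have hpre : ∀ t : Fin k, x ⟨t, by have := t.isLt; omega⟩
        = (Fin.cons b m : Fin (k + 1) → ZMod q) t.castSucc := fun t => hx.1 t
    have h0 := hx.2 0 (by omega)
    have h0' : c ((0 : ℕ) : ZMod 2) = d (Fin.cons b m) := by simp [c, hb]
    have hl := snoc_inj hs _ _ (fun t => by
      rw [← hpre t]; simp) (h0.trans h0')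
    have all : ∀ t : Fin (k + 1), x ⟨t, by have := t.isLt; omega⟩
        = (Fin.cons b m : Fin (k + 1) → ZMod q) t := by
      intro t
      refine Fin.lastCases ?_ (fun t => ?_) t
      · simpa using hl
      · exact hpre t
    have := all i.succ
    simpa using this
  obtain ⟨x, hx, -⟩ := h1 (Fin.init (Fin.cons a m : Fin (k + 1) → ZMod q))
  obtain ⟨x', hx', -⟩ := h1 (Fin.init (Fin.cons a' m : Fin (k + 1) → ZMod q))
  have ka := key a rfl x hx
  have ka' := key a' haa.symm x' hx'
  have agree := lift_unique hs hx hx' 1 (by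
    intro i hi h1 h2
    obtain ⟨i, rfl⟩ : ∃ j, i = j + 1 := ⟨i - 1, by omega⟩
    exact (ka ⟨i, by omega⟩).trans (ka' ⟨i, by omega⟩).symm)
  have := (h2 _ _ x x' hx hx' ⟨1, by omega⟩ ⟨1, by omega⟩ (by
    funext t
    exact agree _ _ (by simp))).1
  have := congrFun this ⟨0, by omega⟩
  simpa [Fin.init] using this

lemma bwd {q n k : ℕ} (hn : 1 ≤ n)
    (d : (Fin (k + 1) → ZMod q) → ZMod q)
    (hc : ∀ m : Fin k → ZMod q, Function.Bijective fun a => d (Fin.cons a m))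
    (hs : ∀ m : Fin k → ZMod q, Function.Bijective fun a => d (Fin.snoc m a)) :
    PropertyD q n k d := by
  intro l hl c hdis
  haveI : NeZero l := ⟨by omega⟩
  refine ⟨fun w => ?_, ?_⟩
  · obtain ⟨x, hx⟩ := lift_exists (n := n) hs c w
    refine ⟨x, hx, fun x' hx' => ?_⟩
    funext i
    exact lift_unique hs hx' hx 0 (fun i hi _ h2 => by
      have h2 : i < k := by omega
      exact (hx'.1 ⟨i, h2⟩).trans (hx.1 ⟨i, h2⟩).symm) i i.2 (Nat.zero_le _)
  · intro w w' x x' hx hx' j j' hv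
    have hv' : ∀ t (ht : t < n + k), x ⟨j + t, by omega⟩ = x' ⟨j' + t, by omega⟩ :=
      fun t ht => congrFun hv ⟨t, ht⟩
    have hjj : ((j : ℕ) : ZMod l) = ((j' : ℕ) : ZMod l) := by
      apply hdis
      funext t
      have ht := t.isLt
      have h1 := hx.2 (j + t) (by omega)
      have h2 := hx'.2 (j' + t) (by omega)
      push_cast at h1 h2
      show c _ = c _
      rw [← h1, ← h2]
      congr 1
      funext u
      have hu := u.isLt
      have := hv' (t + u) (by omega)
      simpa only [add_assoc] using this
    have hj : j = j' := by
      have := congrArg ZMod.val hjj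
      rw [ZMod.val_natCast, ZMod.val_natCast, Nat.mod_eq_of_lt j.2, Nat.mod_eq_of_lt j'.2] at this
      exact Fin.ext this
    subst hj
    refine ⟨?_, rfl⟩
    have := lift_back hc hx hx' j (by omega) (fun i hi h1 h2 => by
      obtain ⟨t, rfl⟩ := Nat.exists_eq_add_of_le h1
      exact hv' t (by omega))
    funext i
    rw [← hx.1 i, ← hx'.1 i]
    exact this _ _ (by omega)

/-- The sliding-window homomorphism induced by `d` has property (D) iff
`d` is bijective in its first variable and in its last variable for every fixed value of the
other variables (i.e. `(x₁, x_{k+1}) ↦ d(x₁,…,x_{k+1})` is a Latin square for every fixed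
middle block). -/
theorem stmt4 (q n k : ℕ) (hq : 2 ≤ q) (hn : 1 ≤ n) (hk : 1 ≤ k)
    (d : (Fin (k + 1) → ZMod q) → ZMod q) :
    PropertyD q n k d ↔
      ((∀ m : Fin k → ZMod q, Function.Bijective fun a => d (Fin.cons a m)) ∧
       (∀ m : Fin k → ZMod q, Function.Bijective fun a => d (Fin.snoc m a))) := by
  exact ⟨fwd hq hn hk d, fun h => bwd hn d h.1 h.2⟩

end DeBruijn
end

section
/- Let n ≥ 1, k ≥ 1 and d : (ZMod 2)^{k+1} → ZMod 2. The induced sliding-window homomorphism D_{n,k} from B_{n+k}(2) to B_n(2) has property (D) if and only if there exists a Boolean function h : (ZMod 2)^{k−1} → ZMod 2 such that d(x_1,…,x_{k+1}) = x_1 + h(x_2,…,x_k) + x_{k+1} for all (x_1,…,x_{k+1}) ∈ (ZMod 2)^{k+1}. -/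
namespace DeBruijn

/-- Index of the `j`-th middle coordinate. -/
def idx (k : ℕ) (j : Fin (k - 1)) : Fin (k + 1) := (Fin.castLE (Nat.sub_le k 1) j).succ

/-- Extension by zero of a finite string. -/
def ext0 {N : ℕ} (x : Fin N → ZMod 2) (i : ℕ) : ZMod 2 := if h : i < N then x ⟨i, h⟩ else 0

lemma ext0_lt {N : ℕ} (x : Fin N → ZMod 2) (i : ℕ) (h : i < N) : ext0 x i = x ⟨i, h⟩ := by
  simp [ext0, h]

lemma isLift_iff (n : ℕ) {k l : ℕ} (d : (Fin (k + 1) → ZMod 2) → ZMod 2)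
    (c : ZMod l → ZMod 2) (w : Fin k → ZMod 2) (x : Fin (l + n - 1 + k) → ZMod 2) :
    IsLift n d c w x ↔ (∀ j : Fin k, ext0 x j = w j) ∧
      ∀ j : ℕ, j < l + n - 1 → d (fun t : Fin (k + 1) => ext0 x (j + t)) = c (j : ZMod l) := by
  unfold IsLift
  refine and_congr (forall_congr' fun j => ?_) (forall_congr' fun j => forall_congr' fun hj => ?_)
  · rw [ext0_lt]
  · have : (fun t : Fin (k + 1) => ext0 x (j + t)) =
        fun t : Fin (k + 1) => x ⟨j + t, by have := t.isLt; omega⟩ := by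
      funext t
      rw [ext0_lt]
    rw [this]

/-- right permutivity, as cancellation -/
def RC {k : ℕ} (d : (Fin (k + 1) → ZMod 2) → ZMod 2) : Prop :=
  ∀ x y : Fin (k + 1) → ZMod 2, (∀ i : Fin (k + 1), (i : ℕ) < k → x i = y i) → d x = d y →
    x (Fin.last k) = y (Fin.last k)

/-- left permutivity, as cancellation -/
def LC {k : ℕ} (d : (Fin (k + 1) → ZMod 2) → ZMod 2) : Prop :=
  ∀ x y : Fin (k + 1) → ZMod 2, (∀ i : Fin (k + 1), 0 < (i : ℕ) → x i = y i) → d x = d y →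
    x 0 = y 0

lemma RC.forward {k : ℕ} {d : (Fin (k + 1) → ZMod 2) → ZMod 2} (hd : RC d) (X Y : ℕ → ZMod 2)
    (s : ℕ) (h0 : ∀ j < k, X (s + j) = Y (s + j)) (m : ℕ)
    (h : ∀ j < m, d (fun t : Fin (k + 1) => X (s + j + t)) =
      d (fun t : Fin (k + 1) => Y (s + j + t))) :
    ∀ j < m + k, X (s + j) = Y (s + j) := by
  intro j
  induction j using Nat.strong_induction_on with
  | _ j ih =>
    intro hj
    by_cases hjk : j < k
    · exact h0 j hjk
    · have := hd _ _ (fun i hi => ?_) (h (j - k) (by omega))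
      · simp only [Fin.val_last] at this
        rwa [show s + (j - k) + k = s + j by omega] at this
      · have := ih (j - k + i) (by omega) (by omega)
        rwa [← add_assoc] at this

lemma LC.backward {k : ℕ} {d : (Fin (k + 1) → ZMod 2) → ZMod 2} (hd : LC d) (X Y : ℕ → ZMod 2)
    (m : ℕ) (h0 : ∀ j < k, X (m + j) = Y (m + j))
    (h : ∀ j < m, d (fun t : Fin (k + 1) => X (j + t)) =
      d (fun t : Fin (k + 1) => Y (j + t))) :
    ∀ j < k, X j = Y j := by
  induction m with
  | zero => simpa using h0
  | succ m ih =>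
    have key : X m = Y m := by
      have := hd _ _ (fun i hi => ?_) (h m (by omega))
      · simpa using this
      · have := h0 (i - 1) (by omega)
        rwa [show m + 1 + ((i : ℕ) - 1) = m + i by omega] at this
    refine ih (fun j hj => ?_) (fun j hj => h j (by omega))
    rcases Nat.eq_zero_or_pos j with rfl | hp
    · simpa using key
    · have := h0 (j - 1) (by omega)
      rwa [show m + 1 + (j - 1) = m + j by omega] at this

/-- The recursively defined lift. -/
def recLift (k : ℕ) (hk : 1 ≤ k) (h : (Fin (k - 1) → ZMod 2) → ZMod 2) (w e : ℕ → ZMod 2) (m : ℕ) :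
    ZMod 2 :=
  if hm : m < k then w m else
    recLift k hk h w e (m - k) + h (fun j => recLift k hk h w e (m - k + (j + 1))) + e (m - k)
termination_by m
decreasing_by
  · omega
  · have := j.isLt
    omega

lemma zmod2_inj (f : ZMod 2 → ZMod 2) (hf : f 0 ≠ f 1) (b : ZMod 2) : f b = f 0 + b := by
  revert f b
  decide

lemma propD_RC (n k : ℕ) (hn : 1 ≤ n) 
    (d : (Fin (k + 1) → ZMod 2) → ZMod 2) (hD : PropertyD 2 n k d) : RC d := by
  intro x y hxy hd
  by_contra hne
  obtain ⟨h1, -⟩ := hD 1 one_pos (fun _ => d x + 1) (fun a b _ => Subsingleton.elim _ _)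
  obtain ⟨z, hz, -⟩ := h1 (fun j => x j.castSucc)
  rw [isLift_iff] at hz
  obtain ⟨hz1, hz2⟩ := hz
  have hz3 := hz2 0 (by omega)
  have hcase : ext0 z k = x (Fin.last k) ∨ ext0 z k = y (Fin.last k) := by
    revert hne
    generalize ext0 z k = p
    generalize x (Fin.last k) = q
    generalize y (Fin.last k) = r
    revert p q r
    decide
  have hpre : ∀ i : Fin (k + 1), (i : ℕ) < k → ext0 z (0 + i) = x i := by
    intro i hi
    rw [zero_add]
    exact hz1 ⟨i, hi⟩
  have hx1 : d x ≠ d x + 1 := by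
    generalize d x = p
    revert p
    decide
  rcases hcase with hc | hc
  · apply hx1
    rw [← hz3]
    congr 1
    funext i
    by_cases hi : (i : ℕ) < k
    · exact (hpre i hi).symm
    · obtain rfl : i = Fin.last k := by ext; simp; omega
      simp [hc]
  · apply hx1
    rw [← hz3, hd]
    congr 1
    funext i
    by_cases hi : (i : ℕ) < k
    · rw [hpre i hi, hxy i hi]
    · obtain rfl : i = Fin.last k := by ext; simp; omega
      simp [hc]

lemma propD_LC (n k : ℕ) (hn : 1 ≤ n) (hk : 1 ≤ k)
    (d : (Fin (k + 1) → ZMod 2) → ZMod 2) (hD : PropertyD 2 n k d) : LC d := by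
  have hR := propD_RC n k hn d hD
  intro x y hxy hd
  have hinj : VertexDisjoint n (fun i : ZMod 2 => i + d x) := by
    intro a b hab
    have := congrFun hab ⟨0, hn⟩
    simpa [cycleVertex] using this
  obtain ⟨h1, h2⟩ := hD 2 two_pos (fun i => i + d x) hinj
  obtain ⟨z, hz, -⟩ := h1 (fun j => x j.castSucc)
  obtain ⟨z', hz', -⟩ := h1 (fun j => y j.castSucc)
  have hw := h2 _ _ z z' hz hz' 1 1
  rw [isLift_iff] at hz hz'
  have first : ∀ (u : Fin (k + 1) → ZMod 2) (v : Fin (2 + n - 1 + k) → ZMod 2),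
      d u = d x → (∀ j : Fin k, ext0 v j = u j.castSucc) →
      d (fun t : Fin (k + 1) => ext0 v (0 + t)) = 0 + d x → ext0 v k = u (Fin.last k) := by
    intro u v hu hv hv0
    have := hR (fun t : Fin (k + 1) => ext0 v (0 + t)) u (fun i hi => by
      simpa using hv ⟨i, hi⟩) (by rw [hv0, hu, zero_add])
    simpa using this
  have e1 := first x z rfl hz.1 (by simpa using hz.2 0 (by omega))
  have e2 := first y z' hd.symm hz'.1 (by simpa using hz'.2 0 (by omega))
  have h0 : ∀ j < k, ext0 z (1 + j) = ext0 z' (1 + j) := by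
    intro j hj
    by_cases hjk : 1 + j < k
    · have a := hz.1 ⟨1 + j, hjk⟩
      have b := hz'.1 ⟨1 + j, hjk⟩
      simp only at a b
      rw [a, b]
      exact hxy _ (by simp)
    · have : 1 + j = k := by omega
      rw [this, e1, e2]
      exact hxy _ (by simp; omega)
  have hall := hR.forward (ext0 z) (ext0 z') 1 h0 n (fun j hj => by
    rw [hz.2 (1 + j) (by omega), hz'.2 (1 + j) (by omega)])
  have := (hw (by
    funext t
    have := hall t t.isLt
    rw [ext0_lt _ _ (by omega), ext0_lt _ _ (by omega)] at this
    exact this)).1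
  have := congrFun this ⟨0, hk⟩
  simpa using this

lemma form_of_cancel (k : ℕ) (hk : 1 ≤ k) (d : (Fin (k + 1) → ZMod 2) → ZMod 2)
    (hR : RC d) (hL : LC d) :
      ∃ h : (Fin (k - 1) → ZMod 2) → ZMod 2,
        ∀ x : Fin (k + 1) → ZMod 2,
          d x = x 0 + h (fun j => x (idx k j)) +
            x (Fin.last k) := by
  refine ⟨fun u => d (fun i => if hi : 0 < (i : ℕ) ∧ (i : ℕ) < k then
    u ⟨(i : ℕ) - 1, by omega⟩ else 0), fun x => ?_⟩
  have a := zmod2_inj (fun b => d (Function.update x (Fin.last k) b)) (fun he => by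
    have := hR _ _ (fun i hi => ?_) he
    · simp at this
    · have : i ≠ Fin.last k := by rintro rfl; simp at hi
      simp [this]) (x (Fin.last k))
  have b := zmod2_inj (fun b => d (Function.update (Function.update x (Fin.last k) 0) 0 b))
    (fun he => by
    have := hL _ _ (fun i hi => ?_) he
    · simp at this
    · have : i ≠ 0 := by rintro rfl; simp at hi
      simp [this]) (x 0)
  have hne : (0 : Fin (k + 1)) ≠ Fin.last k := by
    intro h
    have := congrArg Fin.val h
    simp at this
    omega
  have hu : Function.update (Function.update x (Fin.last k) 0) 0 (x 0) =
      Function.update x (Fin.last k) 0 := by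
    funext i
    by_cases hi : i = 0
    · subst hi
      simp [hne]
    · simp [hi]
  simp only [Function.update_eq_self, hu] at a b
  rw [a, b]
  have hmid : Function.update (Function.update x (Fin.last k) 0) 0 0 =
    (fun i : Fin (k + 1) => if hi : 0 < (i : ℕ) ∧ (i : ℕ) < k then
      x (idx k ⟨(i : ℕ) - 1, by omega⟩) else 0) := by
    funext i
    by_cases hi : i = 0
    · subst hi
      simp
    · by_cases hl : i = Fin.last k
      · subst hl
        simp [hi]
      · have h1 : 0 < (i : ℕ) := Nat.pos_of_ne_zero (fun h => hi (Fin.ext h))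
        have h2 : (i : ℕ) < k := by
          have : (i : ℕ) ≠ k := fun h => hl (Fin.ext h)
          omega
        rw [dif_pos ⟨h1, h2⟩]
        simp only [Function.update_of_ne hi, Function.update_of_ne hl]
        congr 1
        ext
        simp only [idx, Fin.val_succ, Fin.val_castLE]
        omega
  rw [hmid]
  ring

lemma form_RC (k : ℕ) (hk : 1 ≤ k) (d : (Fin (k + 1) → ZMod 2) → ZMod 2)
    (h : (Fin (k - 1) → ZMod 2) → ZMod 2)
    (H : ∀ x : Fin (k + 1) → ZMod 2,
          d x = x 0 + h (fun j => x (idx k j)) +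
            x (Fin.last k)) : RC d := by
  intro x y hxy hd
  rw [H, H] at hd
  have e1 : x 0 = y 0 := hxy 0 (by simp; omega)
  have e2 : (fun j : Fin (k - 1) => x (idx k j)) =
      fun j : Fin (k - 1) => y (idx k j) := by
    funext j
    exact hxy _ (by have := j.isLt; simp only [idx, Fin.val_succ, Fin.val_castLE]; omega)
  rw [e1, e2] at hd
  exact add_left_cancel hd

lemma form_LC (k : ℕ) (hk : 1 ≤ k) (d : (Fin (k + 1) → ZMod 2) → ZMod 2)
    (h : (Fin (k - 1) → ZMod 2) → ZMod 2)
    (H : ∀ x : Fin (k + 1) → ZMod 2,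
          d x = x 0 + h (fun j => x (idx k j)) +
            x (Fin.last k)) : LC d := by
  intro x y hxy hd
  rw [H, H] at hd
  have e1 : x (Fin.last k) = y (Fin.last k) := hxy _ (by simp only [Fin.val_last]; omega)
  have e2 : (fun j : Fin (k - 1) => x (idx k j)) =
      fun j : Fin (k - 1) => y (idx k j) := by
    funext j
    exact hxy _ (by simp [idx])
  rw [e1, e2] at hd
  exact add_right_cancel (add_right_cancel hd)

lemma form_propD (n k : ℕ) (hn : 1 ≤ n) (hk : 1 ≤ k) (d : (Fin (k + 1) → ZMod 2) → ZMod 2)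
    (h : (Fin (k - 1) → ZMod 2) → ZMod 2)
    (H : ∀ x : Fin (k + 1) → ZMod 2,
          d x = x 0 + h (fun j => x (idx k j)) +
            x (Fin.last k)) : PropertyD 2 n k d := by
  have hR := form_RC k hk d h H
  have hL := form_LC k hk d h H
  intro l hl c hc
  constructor
  · intro w
    let X := recLift k hk h (ext0 w) (fun j => c (j : ZMod l))
    have hX : ∀ i, i < l + n - 1 + k →
        ext0 (fun i : Fin (l + n - 1 + k) => X i) i = X i := fun i hi => ext0_lt _ _ hi
    have hx : IsLift n d c w (fun i => X i) := by
      refine (isLift_iff n d c w _).2 ⟨fun j => ?_, fun j hj => ?_⟩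
      · rw [hX _ (by omega)]
        simp only [X]
        rw [recLift, dif_pos j.isLt, ext0_lt _ _ j.isLt]
      · have : (fun t : Fin (k + 1) => ext0 (fun i : Fin (l + n - 1 + k) => X i) (j + t)) =
            fun t : Fin (k + 1) => X (j + t) := by
          funext t
          exact hX _ (by omega)
        rw [this, H]
        have hr : X (j + k) = X j + h (fun t => X (j + (t + 1))) + c (j : ZMod l) := by
          simp only [X]
          rw [recLift, dif_neg (by omega), Nat.add_sub_cancel]
        simp only [hr, Fin.val_zero, add_zero, idx, Fin.val_succ, Fin.val_castLE, Fin.val_last]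
        generalize X j + h (fun t => X (j + (t + 1))) = p
        generalize c (j : ZMod l) = q
        revert p q
        decide
    refine ⟨fun i => X i, hx, ?_⟩
    · intro y hy
      rw [isLift_iff] at hy
      rw [isLift_iff] at hx
      have := hR.forward (ext0 y) (ext0 (fun i : Fin (l + n - 1 + k) => X i)) 0
        (fun j hj => by
          rw [zero_add]
          exact (hy.1 ⟨j, hj⟩).trans (hx.1 ⟨j, hj⟩).symm) (l + n - 1)
        (fun j hj => by rw [zero_add, hy.2 j hj, hx.2 j hj])
      funext i
      have := this i i.isLt
      rw [zero_add, ext0_lt _ _ i.isLt, ext0_lt _ _ i.isLt] at this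
      exact this
  · intro w w' x x' hx hx' j j' hjj
    rw [isLift_iff] at hx hx'
    have hv : ∀ t < n + k, ext0 x (j + t) = ext0 x' (j' + t) := by
      intro t ht
      rw [ext0_lt _ _ (by omega), ext0_lt _ _ (by omega)]
      exact congrFun hjj ⟨t, ht⟩
    have hj : j = j' := by
      have : ((j : ℕ) : ZMod l) = ((j' : ℕ) : ZMod l) := by
        apply hc
        funext t
        simp only [cycleVertex]
        rw [← Nat.cast_add, ← Nat.cast_add, ← hx.2 _ (by omega), ← hx'.2 _ (by omega)]
        congr 1
        funext s
        rw [add_assoc, add_assoc]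
        exact hv _ (by omega)
      rw [ZMod.natCast_eq_natCast_iff] at this
      exact Fin.ext (Nat.ModEq.eq_of_lt_of_lt this j.isLt j'.isLt)
    subst hj
    refine ⟨?_, rfl⟩
    have := hL.backward (ext0 x) (ext0 x') j (fun i hi => hv i (by omega))
      (fun i hi => by rw [hx.2 i (by omega), hx'.2 i (by omega)])
    funext i
    rw [← hx.1, ← hx'.1]
    exact this i i.isLt

/-- In the binary case, the sliding-window homomorphism induced by `d` has
property (D) iff `d(x₁,…,x_{k+1}) = x₁ + h(x₂,…,x_k) + x_{k+1}` for some Boolean function `h`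
of `k-1` variables. -/
theorem stmt6 (n k : ℕ) (hn : 1 ≤ n) (hk : 1 ≤ k)
    (d : (Fin (k + 1) → ZMod 2) → ZMod 2) :
    PropertyD 2 n k d ↔
      ∃ h : (Fin (k - 1) → ZMod 2) → ZMod 2,
        ∀ x : Fin (k + 1) → ZMod 2,
          d x = x 0 + h (fun j => x ⟨(j : ℕ) + 1, by have := j.isLt; omega⟩) +
            x ⟨k, by omega⟩ := by
  constructor
  · intro hD
    exact form_of_cancel k hk d (propD_RC n k hn d hD) (propD_LC n k hn hk d hD)
  · rintro ⟨h, H⟩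
    exact form_propD n k hn hk d h H

end DeBruijn
end

section
/- Let k ≥ 1 and f : (ZMod 2)^{k+1} → ZMod 2. Then f is bijective in its first variable (for every fixed value of the other k variables) and bijective in its last variable (for every fixed value of the other k variables) if and only if there exists h : (ZMod 2)^{k−1} → ZMod 2 such that f(x_1,…,x_{k+1}) = x_1 + h(x_2,…,x_k) + x_{k+1} for all (x_1,…,x_{k+1}) ∈ (ZMod 2)^{k+1}. -/
namespace DeBruijn

theorem aux_bij : ∀ g : ZMod 2 → ZMod 2, Function.Bijective g → ∀ a, g a = a + g 0 := by
  intro g hg a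
  have h1 : g 1 ≠ g 0 := fun h => absurd (hg.1 h) (by decide)
  have key : ∀ u v a : ZMod 2, u ≠ v → (a = 0 ∨ (a = 1 ∧ u = 1 + v)) := by decide
  rcases key (g 1) (g 0) a h1 with h | ⟨h, h'⟩
  · subst h; simp
  · subst h; exact h'

/-- A Boolean function `f` of `k+1` variables is bijective in its first
variable and in its last variable (for every fixed value of the other variables) iff
`f(x₁,…,x_{k+1}) = x₁ + h(x₂,…,x_k) + x_{k+1}` for some `h : (ZMod 2)^{k-1} → ZMod 2`. -/
theorem stmt7 (k : ℕ) (hk : 1 ≤ k) (f : (Fin (k + 1) → ZMod 2) → ZMod 2) :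
    ((∀ m : Fin k → ZMod 2, Function.Bijective fun a => f (Fin.cons a m)) ∧
     (∀ m : Fin k → ZMod 2, Function.Bijective fun a => f (Fin.snoc m a))) ↔
    ∃ h : (Fin (k - 1) → ZMod 2) → ZMod 2,
      ∀ x : Fin (k + 1) → ZMod 2,
        f x = x 0 + h (fun j => x ⟨(j : ℕ) + 1, by have := j.isLt; omega⟩) +
          x ⟨k, by omega⟩ := by
  obtain ⟨n, rfl⟩ : ∃ n, k = n + 1 := ⟨k - 1, by omega⟩
  constructor
  · rintro ⟨h1, h2⟩
    refine ⟨fun y : Fin n → ZMod 2 => f (Fin.snoc (Fin.cons 0 y : Fin (n + 1) → ZMod 2) 0), ?_⟩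
    intro x
    have e1 := aux_bij _ (h1 (Fin.tail x)) (x 0)
    have e2 := aux_bij _ (h2 (Fin.cons 0 (fun j : Fin n => x j.succ.castSucc)))
      (x (Fin.last (n + 1)))
    simp only [Fin.cons_self_tail] at e1
    have e3 : (Fin.cons 0 (Fin.tail x) : Fin (n + 1 + 1) → ZMod 2) =
        Fin.snoc (Fin.cons 0 (fun j : Fin n => x j.succ.castSucc) : Fin (n + 1) → ZMod 2)
          (x (Fin.last (n + 1))) := by
      rw [← Fin.cons_snoc_eq_snoc_cons]
      congr 1
      exact (Fin.snoc_init_self (Fin.tail x)).symm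
    rw [e1, e3]
    refine (congrArg (x 0 + ·) e2).trans ?_
    change _ + (_ + _) = _ + _ + x (Fin.last (n + 1))
    rw [add_comm (x (Fin.last (n + 1))), ← add_assoc]
    rfl
  · rintro ⟨h, hf⟩
    constructor
    · intro m
      have : (fun a => f (Fin.cons a m)) = fun a =>
          a + (h (fun j : Fin n => m j.castSucc) + m (Fin.last n)) := by
        funext a
        rw [hf, add_assoc]
        rfl
      rw [this]
      exact (Equiv.addRight _).bijective
    · intro m
      have : (fun a => f (Fin.snoc m a)) = fun a =>
          (m 0 + h (fun j : Fin n => m j.succ)) + a := by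
        funext a
        rw [hf]
        congr 1
        · congr 1
          congr 1
          funext j
          exact Fin.snoc_castSucc (α := fun _ => ZMod 2) a m j.succ
        · exact Fin.snoc_last (α := fun _ => ZMod 2) a m
      rw [this]
      exact (Equiv.addLeft _).bijective

end DeBruijn
end

section
/- Let n ≥ 1 and let b_1,…,b_{2^n} ∈ ZMod 2 be a De Bruijn sequence of order n, i.e., the 2^n cyclic windows (b_i, b_{i+1}, …, b_{i+n−1}) (indices taken mod 2^n) are pairwise distinct. For a seed (z_1, z_2) ∈ (ZMod 2)^2 define z_i = b_{i−2} + z_{i−2} + z_{i−1} for i = 3,…,2^n+2. For j ∈ {0,1,2} let a_j = Σ b_m, the sum in ZMod 2 over all m with 1 ≤ m ≤ 2^n and m ≡ j (mod 3). Then there is exactly one seed (z_1,z_2) ∈ (ZMod 2)^2 satisfying (z_{2^n+1}, z_{2^n+2}) = (z_1, z_2), and it is given by (z_1, z_2) = (a_0 + a_1, a_1 + a_2) if n is even, and (z_1, z_2) = (a_0 + a_2, a_1 + a_0) if n is odd. -/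
namespace DeBruijn

lemma aux_main (N : ℕ) (b : ℕ → ZMod 2) (f : ℕ → ℕ → ZMod 2)
    (hf : ∀ j k, f j k = ∑ m ∈ Finset.Icc 1 k, if m % 3 = j then b m else 0)
    (z : ℕ → ZMod 2)
    (hz : ∀ i : ℕ, 3 ≤ i → i ≤ N + 2 → z i = b (i - 2) + z (i - 2) + z (i - 1)) :
    ∀ k, k ≤ N →
      (k % 3 = 0 → z (k + 1) = z 1 + f 1 k + f 2 k ∧ z (k + 2) = z 2 + f 0 k + f 2 k) ∧
      (k % 3 = 1 → z (k + 1) = z 2 + f 0 k + f 2 k ∧ z (k + 2) = z 1 + z 2 + f 0 k + f 1 k) ∧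
      (k % 3 = 2 → z (k + 1) = z 1 + z 2 + f 0 k + f 1 k ∧ z (k + 2) = z 1 + f 1 k + f 2 k) := by
  have hs : ∀ j k, f j (k + 1) = f j k + if (k + 1) % 3 = j then b (k + 1) else 0 := by
    intro j k
    rw [hf, hf, Finset.sum_Icc_succ_top (by omega)]
  intro k
  induction k with
  | zero => intro _; simp [hf]
  | succ k ih =>
    intro hk
    have ih := ih (by omega)
    have h3 := hz (k + 3) (by omega) (by omega)
    have e1 : k + 3 - 2 = k + 1 := by omega
    have e2 : k + 3 - 1 = k + 2 := by omega
    rw [e1, e2] at h3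
    obtain ⟨i0, i1, i2⟩ := ih
    have key : ∀ x y c0 c1 c2 β : ZMod 2,
        β + (x + c1 + c2) + (y + c0 + c2) = x + y + c0 + (c1 + β) ∧
        β + (y + c0 + c2) + (x + y + c0 + c1) = x + c1 + (c2 + β) ∧
        β + (x + y + c0 + c1) + (x + c1 + c2) = y + (c0 + β) + c2 := by decide
    have hm : k % 3 = 0 ∨ k % 3 = 1 ∨ k % 3 = 2 := by omega
    obtain ⟨k0, k1, k2⟩ := key (z 1) (z 2) (f 0 k) (f 1 k) (f 2 k) (b (k + 1))
    rcases hm with h | h | h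
    · have h' : (k + 1) % 3 = 1 := by omega
      obtain ⟨u, v⟩ := i0 h
      rw [u, v] at h3
      simp [hs, h', v, h3, k0]
    · have h' : (k + 1) % 3 = 2 := by omega
      obtain ⟨u, v⟩ := i1 h
      rw [u, v] at h3
      simp [hs, h', v, h3, k1]
    · have h' : (k + 1) % 3 = 0 := by omega
      obtain ⟨u, v⟩ := i2 h
      rw [u, v] at h3
      simp [hs, h', v, h3, k2]

lemma aux_exists (b : ℕ → ZMod 2) (p : ZMod 2 × ZMod 2) :
    ∃ z : ℕ → ZMod 2, z 1 = p.1 ∧ z 2 = p.2 ∧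
      ∀ i : ℕ, 3 ≤ i → z i = b (i - 2) + z (i - 2) + z (i - 1) := by
  let s : ℕ → ZMod 2 × ZMod 2 :=
    fun k => Nat.rec p (fun k q => (q.2, b (k + 1) + q.1 + q.2)) k
  refine ⟨fun i => (s (i - 1)).1, rfl, rfl, ?_⟩
  intro i hi
  obtain ⟨k, rfl⟩ : ∃ k, i = k + 3 := ⟨i - 3, by omega⟩
  rfl

lemma aux_mod (n : ℕ) : (n % 2 = 0 → 2 ^ n % 3 = 1) ∧ (n % 2 = 1 → 2 ^ n % 3 = 2) := by
  induction n with
  | zero => simp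
  | succ k ih => rw [pow_succ]; omega


/-- Let `b₁,…,b_{2^n}` be a binary De Bruijn sequence of order `n` (indexed
cyclically by `ZMod (2^n)`, with `b_m = b (m mod 2^n)`).  Running the preimage recursion
`z_i = b_{i-2} + z_{i-2} + z_{i-1}` (for `i = 3,…,2^n+2`) of the sliding-window map induced by
`d(x₁,x₂,x₃) = x₁+x₂+x₃` from a seed `(z₁,z₂)`, there is exactly one seed that closes up,
i.e. with `(z_{2^n+1}, z_{2^n+2}) = (z₁, z₂)`, and it is `(a₀+a₁, a₁+a₂)` if `n` is even and
`(a₀+a₂, a₁+a₀)` if `n` is odd, where `a_j = Σ_{1 ≤ m ≤ 2^n, m ≡ j (mod 3)} b_m`. -/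
theorem stmt8 (n : ℕ) (hn : 1 ≤ n) (b : ZMod (2 ^ n) → ZMod 2)
    (hdb : Function.Injective fun i : ZMod (2 ^ n) =>
      (fun t : Fin n => b (i + ((t : ℕ) : ZMod (2 ^ n)))))
    (a : ℕ → ZMod 2)
    (ha : ∀ j, a j = ∑ m ∈ Finset.Icc 1 (2 ^ n),
      if m % 3 = j then b ((m : ZMod (2 ^ n))) else 0)
    (P : ZMod 2 × ZMod 2 → Prop)
    (hP : ∀ p, P p ↔ ∃ z : ℕ → ZMod 2, z 1 = p.1 ∧ z 2 = p.2 ∧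
      (∀ i : ℕ, 3 ≤ i → i ≤ 2 ^ n + 2 →
        z i = b (((i - 2 : ℕ) : ZMod (2 ^ n))) + z (i - 2) + z (i - 1)) ∧
      z (2 ^ n + 1) = p.1 ∧ z (2 ^ n + 2) = p.2) :
    (∃! p : ZMod 2 × ZMod 2, P p) ∧
    P (if n % 2 = 0 then (a 0 + a 1, a 1 + a 2) else (a 0 + a 2, a 1 + a 0)) := by
  have hf : ∀ j k : ℕ, (fun j k : ℕ => ∑ m ∈ Finset.Icc 1 k,
      if m % 3 = j then b ((m : ZMod (2 ^ n))) else 0) j k = ∑ m ∈ Finset.Icc 1 k,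
      if m % 3 = j then (fun m : ℕ => b (m : ZMod (2 ^ n))) m else 0 := fun _ _ => rfl
  have hmod := aux_mod n
  have hmain := fun z hz => aux_main (2 ^ n) (fun m : ℕ => b (m : ZMod (2 ^ n))) _ hf z hz _ le_rfl
  simp only [← ha] at hmain
  rcases Nat.mod_two_eq_zero_or_one n with h | h
  · have hN := hmod.1 h
    have hc : ∀ p, P p ↔ p.2 + a 0 + a 2 = p.1 ∧ p.1 + p.2 + a 0 + a 1 = p.2 := by
      intro p
      rw [hP]
      constructor
      · rintro ⟨z, h1, h2, hz, h3, h4⟩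
        obtain ⟨u, v⟩ := (hmain z hz).2.1 hN
        rw [← h1, ← h2, ← u, ← v, h1, h2]
        exact ⟨h3, h4⟩
      · rintro ⟨h3, h4⟩
        obtain ⟨z, h1, h2, hz⟩ := aux_exists (fun m : ℕ => b (m : ZMod (2 ^ n))) p
        obtain ⟨u, v⟩ := (hmain z (fun i hi _ => hz i hi)).2.1 hN
        refine ⟨z, h1, h2, fun i hi _ => hz i hi, ?_, ?_⟩
        · rw [u, h2, h3]
        · rw [v, h1, h2, h4]
    simp only [hc, h, if_true]
    generalize a 0 = x
    generalize a 1 = y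
    generalize a 2 = w
    clear * -
    unfold ExistsUnique
    revert x y w
    decide
  · have hN := hmod.2 h
    have hc : ∀ p, P p ↔ p.1 + p.2 + a 0 + a 1 = p.1 ∧ p.1 + a 1 + a 2 = p.2 := by
      intro p
      rw [hP]
      constructor
      · rintro ⟨z, h1, h2, hz, h3, h4⟩
        obtain ⟨u, v⟩ := (hmain z hz).2.2 hN
        rw [← h1, ← h2, ← u, ← v, h1, h2]
        exact ⟨h3, h4⟩
      · rintro ⟨h3, h4⟩
        obtain ⟨z, h1, h2, hz⟩ := aux_exists (fun m : ℕ => b (m : ZMod (2 ^ n))) p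
        obtain ⟨u, v⟩ := (hmain z (fun i hi _ => hz i hi)).2.2 hN
        refine ⟨z, h1, h2, fun i hi _ => hz i hi, ?_, ?_⟩
        · rw [u, h1, h2, h3]
        · rw [v, h1, h4]
    simp only [hc, h, one_ne_zero, if_false]
    generalize a 0 = x
    generalize a 1 = y
    generalize a 2 = w
    clear * -
    unfold ExistsUnique
    revert x y w
    decide

end DeBruijn
end

section
/- Let n ≥ 1, let Γ be a De Bruijn cycle of order n in B_n(2) (a vertex-disjoint cycle of length 2^n whose vertices are all of (ZMod 2)^n), and let D_{n,2} : (ZMod 2)^{n+2} → (ZMod 2)^n be the sliding-window homomorphism induced by d(x_1,x_2,x_3) = x_1 + x_2 + x_3. Then the vertex set (ZMod 2)^{n+2} of B_{n+2}(2) is partitioned into the vertex sets of exactly two vertex-disjoint cycles, one of length 2^n and one of length 3·2^n, and D_{n,2} maps each of these cycles onto Γ (every vertex of each cycle is mapped to a vertex of Γ, and the symbol sequence of the D_{n,2}-image of each cycle is the symbol sequence of Γ repeated once, respectively three times). -/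
namespace DeBruijn

lemma hh_inj : ∀ a b : ZMod 3, (if a = 0 then (0 : ZMod 2) else 1) = (if b = 0 then 0 else 1) →
    (if a + 1 = 0 then (0 : ZMod 2) else 1) = (if b + 1 = 0 then 0 else 1) → a = b := by decide

lemma hh_ne : ∀ a : ZMod 3, (if a = 0 then (0 : ZMod 2) else 1) = 0 →
    (if a + 1 = 0 then (0 : ZMod 2) else 1) = 0 → False := by decide

lemma hh_sum : ∀ a : ZMod 3, (if a = 0 then (0 : ZMod 2) else 1) +
    (if a + 1 = 0 then (0 : ZMod 2) else 1) + (if a + 2 = 0 then (0 : ZMod 2) else 1) = 0 := by decide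

lemma hh_alg : ∀ a b c d : ZMod 2, a + b + c = 0 → b + c + d = 0 → d = a := by decide

lemma hh_sub : ∀ a b c d e f : ZMod 2, a + b + c = d + e + f →
    (a - d) + (b - e) + (c - f) = 0 := by decide

lemma hh_three : ∀ a : ZMod 2, a + a + a = 0 → a = 0 := by decide

lemma exists_lift (n : ℕ) (γ : ZMod (2 ^ n) → ZMod 2) :
    ∃ X : ZMod (2 ^ n) → ZMod 2, ∀ p, X p + X (p + 1) + X (p + 2) = γ p := by
  have hinj : Function.Injective
      (fun (X : ZMod (2 ^ n) → ZMod 2) (p : ZMod (2 ^ n)) => X p + X (p + 1) + X (p + 2)) := by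
    intro X Y hXY
    have h0 : ∀ p, (X p - Y p) + (X (p + 1) - Y (p + 1)) + (X (p + 2) - Y (p + 2)) = 0 :=
      fun p => hh_sub _ _ _ _ _ _ (congrFun hXY p)
    have h3 : ∀ p, X (p + 3) - Y (p + 3) = X p - Y p := by
      intro p
      have h1 := h0 (p + 1)
      rw [show p + 1 + 1 = p + 2 by ring, show p + 1 + 2 = p + 3 by ring] at h1
      exact hh_alg _ _ _ _ (h0 p) h1
    have hk : ∀ k : ℕ, ∀ p, X (p + k * 3) - Y (p + k * 3) = X p - Y p := by
      intro k
      induction k with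
      | zero => intro p; simp
      | succ k ih =>
        intro p
        rw [← ih p, ← h3 (p + k * 3)]
        push_cast
        rw [show p + (k + 1) * 3 = p + (k : ZMod (2 ^ n)) * 3 + 3 by ring]
    have hu : IsUnit ((3 : ℕ) : ZMod (2 ^ n)) := by
      rw [ZMod.isUnit_iff_coprime]
      exact Nat.Coprime.pow_right n (by norm_num)
    have hc : ∀ p q, X q - Y q = X p - Y p := by
      intro p q
      obtain ⟨v, hv⟩ := hu.exists_left_inv
      have := hk ((q - p) * v).val p
      rw [ZMod.natCast_zmod_val] at this
      have e : p + (q - p) * v * 3 = q := by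
        push_cast at hv
        rw [mul_assoc, hv]; ring
      rwa [e] at this
    funext p
    have := h0 p
    rw [hc p (p + 1), hc p (p + 2)] at this
    exact sub_eq_zero.mp (hh_three _ this)
  obtain ⟨X, hX⟩ := Finite.surjective_of_injective hinj γ
  exact ⟨X, fun p => congrFun hX p⟩

lemma crt_ext (n : ℕ) (p q : ZMod (3 * 2 ^ n))
    (h2 : ZMod.castHom (dvd_mul_left (2 ^ n) 3) (ZMod (2 ^ n)) p =
      ZMod.castHom (dvd_mul_left (2 ^ n) 3) (ZMod (2 ^ n)) q)
    (h3 : ZMod.castHom (dvd_mul_right 3 (2 ^ n)) (ZMod 3) p =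
      ZMod.castHom (dvd_mul_right 3 (2 ^ n)) (ZMod 3) q) : p = q := by
  have hco : Nat.Coprime 3 (2 ^ n) := Nat.Coprime.pow_right n (by norm_num)
  rw [← ZMod.natCast_zmod_val p, ← ZMod.natCast_zmod_val q] at *
  rw [map_natCast, map_natCast, ZMod.natCast_eq_natCast_iff] at h2 h3
  rw [ZMod.natCast_eq_natCast_iff]
  exact (Nat.modEq_and_modEq_iff_modEq_mul hco).mp ⟨h3, h2⟩

/-- For any binary De Bruijn cycle `Γ` of order `n` and the sliding-window
homomorphism `D_{n,2}` induced by `d(x₁,x₂,x₃) = x₁+x₂+x₃`, the vertex set of `B_{n+2}(2)` is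
partitioned into the vertex sets of exactly two vertex-disjoint cycles, one of length `2^n`
and one of length `3·2^n`, each mapped by `D_{n,2}` onto `Γ` (once, resp. three times). -/
theorem stmt9 (n : ℕ) (hn : 1 ≤ n) (γ : ZMod (2 ^ n) → ZMod 2)
    (hvd : Function.Injective (cycleVertex n γ))
    (hall : Function.Surjective (cycleVertex n γ))
    (D : (Fin (n + 2) → ZMod 2) → Fin n → ZMod 2)
    (hD : ∀ (x : Fin (n + 2) → ZMod 2) (i : Fin n),
      D x i = x ⟨i, by have := i.isLt; omega⟩ + x ⟨(i : ℕ) + 1, by have := i.isLt; omega⟩ +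
        x ⟨(i : ℕ) + 2, by have := i.isLt; omega⟩) :
    ∃ (X₁ : ZMod (2 ^ n) → ZMod 2) (X₂ : ZMod (3 * 2 ^ n) → ZMod 2),
      VertexDisjoint (n + 2) X₁ ∧ VertexDisjoint (n + 2) X₂ ∧
      Disjoint (Set.range (cycleVertex (n + 2) X₁)) (Set.range (cycleVertex (n + 2) X₂)) ∧
      Set.range (cycleVertex (n + 2) X₁) ∪ Set.range (cycleVertex (n + 2) X₂) = Set.univ ∧
      (∀ p : ZMod (2 ^ n), X₁ p + X₁ (p + 1) + X₁ (p + 2) = γ p) ∧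
      (∀ p : ZMod (2 ^ n), D (cycleVertex (n + 2) X₁ p) = cycleVertex n γ p) ∧
      (∀ p : ZMod (3 * 2 ^ n), X₂ p + X₂ (p + 1) + X₂ (p + 2) =
        γ (ZMod.castHom (dvd_mul_left (2 ^ n) 3) (ZMod (2 ^ n)) p)) ∧
      (∀ p : ZMod (3 * 2 ^ n), D (cycleVertex (n + 2) X₂ p) =
        cycleVertex n γ (ZMod.castHom (dvd_mul_left (2 ^ n) 3) (ZMod (2 ^ n)) p)) := by
  obtain ⟨X₁, hX₁⟩ := exists_lift n γ
  set f := ZMod.castHom (dvd_mul_left (2 ^ n) 3) (ZMod (2 ^ n)) with hf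
  set g := ZMod.castHom (dvd_mul_right 3 (2 ^ n)) (ZMod 3) with hg
  let h : ZMod 3 → ZMod 2 := fun a => if a = 0 then 0 else 1
  let X₂ : ZMod (3 * 2 ^ n) → ZMod 2 := fun p => X₁ (f p) + h (g p)
  have hX₂ : ∀ p, X₂ p + X₂ (p + 1) + X₂ (p + 2) = γ (f p) := by
    intro p
    have e1 := hX₁ (f p)
    have e2 : h (g p) + h (g p + 1) + h (g p + 2) = 0 := hh_sum (g p)
    simp only [X₂, map_add, map_one, map_ofNat]
    linear_combination e1 + e2
  have hD₁ : ∀ p, D (cycleVertex (n + 2) X₁ p) = cycleVertex n γ p := by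
    intro p
    funext i
    rw [hD]
    simp only [cycleVertex]
    rw [← hX₁]
    push_cast
    simp only [add_assoc]
  have hD₂ : ∀ p, D (cycleVertex (n + 2) X₂ p) = cycleVertex n γ (f p) := by
    intro p
    funext i
    rw [hD]
    simp only [cycleVertex]
    have := hX₂ (p + ((i : ℕ) : ZMod (3 * 2 ^ n)))
    rw [map_add, map_natCast] at this
    rw [← this]
    push_cast
    simp only [add_assoc]
  have i₁ : VertexDisjoint (n + 2) X₁ := by
    intro p q hpq
    apply hvd
    rw [← hD₁, ← hD₁, hpq]
  have i₂ : VertexDisjoint (n + 2) X₂ := by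
    intro p q hpq
    have e : f p = f q := by
      apply hvd
      rw [← hD₂, ← hD₂, hpq]
    have a0 := congrFun hpq ⟨0, by omega⟩
    have a1 := congrFun hpq ⟨1, by omega⟩
    simp only [cycleVertex, X₂, map_add, map_one, e, Nat.cast_zero, Nat.cast_one, add_zero,
      add_right_inj] at a0 a1
    exact crt_ext n p q e (hh_inj _ _ a0 a1)
  have hne : ∀ p q, cycleVertex (n + 2) X₁ p ≠ cycleVertex (n + 2) X₂ q := by
    intro p q hpq
    have e : p = f q := by
      apply hvd
      rw [← hD₁, ← hD₂, hpq]
    have a0 := congrFun hpq ⟨0, by omega⟩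
    have a1 := congrFun hpq ⟨1, by omega⟩
    simp only [cycleVertex, X₂, map_add, map_one, e, Nat.cast_zero, Nat.cast_one, add_zero,
      left_eq_add] at a0 a1
    exact hh_ne _ a0 a1
  refine ⟨X₁, X₂, i₁, i₂, ?_, ?_, hX₁, hD₁, hX₂, hD₂⟩
  · rw [Set.disjoint_left]
    rintro _ ⟨p, rfl⟩ ⟨q, hq⟩
    exact hne p q hq.symm
  · have hbij : Function.Bijective
        (Sum.elim (cycleVertex (n + 2) X₁) (cycleVertex (n + 2) X₂)) := by
      rw [Fintype.bijective_iff_injective_and_card]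
      refine ⟨Function.Injective.sumElim i₁ i₂ hne, ?_⟩
      rw [Fintype.card_sum, ZMod.card, ZMod.card, Fintype.card_fun, ZMod.card, Fintype.card_fin]
      ring
    rw [← Set.Sum.elim_range]
    exact hbij.surjective.range_eq

end DeBruijn
end

section
/- Let n ≥ 2 and let D : (ZMod 2)^n → (ZMod 2)^{n−1} be Lempel's D-morphism D(x_1,…,x_n) = (x_1+x_2, x_2+x_3, …, x_{n−1}+x_n). Let Γ be a vertex-disjoint cycle of length p in B_{n−1}(2) with symbol sequence γ : ZMod p → ZMod 2. Then W(Γ) = 0 (Γ has an even number of ones) if and only if there exists a vertex-disjoint cycle C of length p in B_n(2), with symbol sequence x : ZMod p → ZMod 2 satisfying x_i + x_{i+1} = γ_i for all i ∈ ZMod p, such that C is primitive; in that case the complement cycle C + 1 (symbol sequence i ↦ x_i + 1) is also a vertex-disjoint cycle of length p with D-image Γ, and C and C + 1 have no vertex in common. -/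
namespace DeBruijn

theorem key_aux (n p : ℕ) (γ x : ZMod p → ZMod 2) (hΓ : VertexDisjoint (n - 1) γ)
    (hx : ∀ i : ZMod p, x i + x (i + 1) = γ i) (i j : ZMod p) (μ : ZMod 2)
    (h : ∀ t : Fin n, cycleVertex n x j t = cycleVertex n x i t + μ) : j = i := by
  apply hΓ
  funext t
  have h1 := h ⟨t.1, by omega⟩
  have h2 := h ⟨t.1 + 1, by omega⟩
  simp only [cycleVertex, Nat.cast_add, Nat.cast_one, ← add_assoc] at h1 h2 ⊢
  rw [← hx, ← hx, h1, h2]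
  have := CharTwo.add_self_eq_zero μ
  linear_combination this

theorem two_aux (a b : ZMod 2) : a + b = b - a := by
  rw [CharTwo.sub_eq_add, add_comm]

/-- Lempel, even case. A vertex-disjoint cycle `Γ` of length `p` in
`B_{n-1}(2)` has weight `0` (an even number of ones) iff it is the `D`-morphic image
(`D(x)_i = x_i + x_{i+1}`) of a primitive vertex-disjoint cycle `C` of length `p` in `B_n(2)`;
in that case the complement cycle `C + 1` is also a vertex-disjoint cycle of length `p` with
`D`-image `Γ`, and `C` and `C + 1` have no vertex in common. -/
theorem stmt10 (n p : ℕ) (hn : 2 ≤ n) (hp : 0 < p)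
    (γ : ZMod p → ZMod 2) (hΓ : VertexDisjoint (n - 1) γ) :
    weight p γ = 0 ↔
      ∃ x : ZMod p → ZMod 2,
        VertexDisjoint n x ∧
        (∀ i : ZMod p, x i + x (i + 1) = γ i) ∧
        Primitive n x ∧
        VertexDisjoint n (fun i => x i + 1) ∧
        (∀ i : ZMod p, (x i + 1) + (x (i + 1) + 1) = γ i) ∧
        Disjoint (Set.range (cycleVertex n x))
          (Set.range (cycleVertex n (fun i => x i + 1))) := by
  have : NeZero p := ⟨hp.ne'⟩
  constructor
  · intro hw
    let x : ZMod p → ZMod 2 := fun i => ∑ k ∈ Finset.range i.val, γ ((k : ℕ) : ZMod p)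
    have hx : ∀ i : ZMod p, x i + x (i + 1) = γ i := by
      intro i
      have hs : ∑ k ∈ Finset.range (i.val + 1), γ ((k : ℕ) : ZMod p) = x i + γ i := by
        rw [Finset.sum_range_succ, ZMod.natCast_zmod_val]
      have hS : x (i + 1) = x i + γ i := by
        rw [← hs]
        by_cases hlt : i.val + 1 < p
        · have : (i + 1).val = i.val + 1 := by
            rw [← ZMod.val_natCast_of_lt hlt, Nat.cast_add, ZMod.natCast_zmod_val, Nat.cast_one]
          simp only [x, this]
        · have he : i.val + 1 = p := by
            have := ZMod.val_lt i
            omega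
          have h0 : i + 1 = 0 := by
            have : ((i.val + 1 : ℕ) : ZMod p) = 0 := by rw [he]; simp
            simpa using this
          rw [he, h0]
          unfold weight at hw
          rw [hw]
          simp [x]
      rw [hS, ← add_assoc, CharTwo.add_self_eq_zero, zero_add]
    have hx' : ∀ i : ZMod p, (x i + 1) + (x (i + 1) + 1) = γ i := by
      intro i
      rw [← hx]
      have := CharTwo.add_self_eq_zero (1 : ZMod 2)
      linear_combination this
    have hP : Primitive n x := by
      intro i j μ h
      have e := key_aux n p γ x hΓ hx i j μ h
      subst e
      simpa using h ⟨0, by omega⟩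
    refine ⟨x, ?_, hx, hP, ?_, hx', ?_⟩
    · intro j i h
      exact key_aux n p γ x hΓ hx i j 0 (fun t => by rw [h, add_zero])
    · intro j i h
      exact key_aux n p γ _ hΓ hx' i j 0 (fun t => by rw [h, add_zero])
    · rw [Set.disjoint_left]
      rintro _ ⟨j, rfl⟩ ⟨i, h⟩
      exact one_ne_zero (hP i j 1 (fun t => (congrFun h t).symm))
  · rintro ⟨x, -, hx, -⟩
    unfold weight
    have : ∀ k ∈ Finset.range p, γ ((k : ℕ) : ZMod p)
        = (fun m : ℕ => x (m : ZMod p)) (k + 1) - (fun m : ℕ => x (m : ZMod p)) k := by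
      intro k _
      rw [← hx, two_aux]
      simp
    rw [Finset.sum_congr rfl this, Finset.sum_range_sub (fun m : ℕ => x (m : ZMod p))]
    simp

end DeBruijn
end

section
/- Let n ≥ 2 and let D : (ZMod 2)^n → (ZMod 2)^{n−1} be Lempel's D-morphism D(x_1,…,x_n) = (x_1+x_2, x_2+x_3, …, x_{n−1}+x_n). Let Γ be a vertex-disjoint cycle of length p in B_{n−1}(2) with symbol sequence γ : ZMod p → ZMod 2. Then W(Γ) = 1 (Γ has an odd number of ones) if and only if there exists a binary word x_1,…,x_p such that the cyclic symbol sequence X of length 2p defined by X_i = x_i and X_{p+i} = x_i + 1 (for i = 1,…,p) defines a vertex-disjoint (self-dual) cycle in B_n(2) satisfying X_j + X_{j+1} = γ_{j mod p} for all j ∈ ZMod 2p. -/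
namespace DeBruijn

theorem S_add (p : ℕ) (γ : ZMod p → ZMod 2) (h : weight p γ = 1) (k : ℕ) :
    ∑ i ∈ Finset.range (p + k), γ (i : ZMod p) = ∑ i ∈ Finset.range k, γ (i : ZMod p) + 1 := by
  rw [Finset.sum_range_add]
  have : ∑ i ∈ Finset.range p, γ (i : ZMod p) = 1 := h
  rw [this, add_comm]
  simp

theorem S_per (p : ℕ) (γ : ZMod p → ZMod 2) (h : weight p γ = 1) (k : ℕ) :
    ∑ i ∈ Finset.range (k % (2 * p)), γ (i : ZMod p) = ∑ i ∈ Finset.range k, γ (i : ZMod p) := by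
  have key : ∀ m r : ℕ, ∑ i ∈ Finset.range (r + 2 * p * m), γ (i : ZMod p)
      = ∑ i ∈ Finset.range r, γ (i : ZMod p) := by
    intro m r
    induction m with
    | zero => simp
    | succ m ih =>
      have e : r + 2 * p * (m + 1) = p + (p + (r + 2 * p * m)) := by ring
      rw [e, S_add p γ h, S_add p γ h, ih, add_assoc]
      have : (1 + 1 : ZMod 2) = 0 := by decide
      rw [this, add_zero]
  conv_rhs => rw [← Nat.mod_add_div k (2 * p)]
  rw [key]

/-- Lempel, odd case. A vertex-disjoint cycle `Γ` of length `p` in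
`B_{n-1}(2)` has weight `1` (an odd number of ones) iff it is the `D`-morphic image
(`D(x)_i = x_i + x_{i+1}`, traversed twice) of a self-dual vertex-disjoint cycle of length
`2p` in `B_n(2)`, whose symbol sequence is a word `x₁,…,x_p` followed by its bitwise
complement. -/
theorem stmt11 (n p : ℕ) (hn : 2 ≤ n) (hp : 0 < p)
    (γ : ZMod p → ZMod 2) (hΓ : VertexDisjoint (n - 1) γ) :
    weight p γ = 1 ↔
      ∃ (x : ZMod p → ZMod 2) (X : ZMod (2 * p) → ZMod 2),
        (∀ i : ℕ, i < p →
          X ((i : ℕ) : ZMod (2 * p)) = x ((i : ℕ) : ZMod p) ∧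
          X (((p + i : ℕ) : ZMod (2 * p))) = x ((i : ℕ) : ZMod p) + 1) ∧
        VertexDisjoint n X ∧
        (∀ j : ZMod (2 * p), X j + X (j + 1) =
          γ (ZMod.castHom (dvd_mul_left p 2) (ZMod p) j)) := by
  have two : ∀ a b : ZMod 2, a + (a + b) = b := by decide
  constructor
  · intro h
    have : NeZero p := ⟨hp.ne'⟩
    have : NeZero (2 * p) := ⟨by omega⟩
    obtain ⟨S, hS⟩ : ∃ S : ℕ → ZMod 2, S = fun k => ∑ i ∈ Finset.range k, γ (i : ZMod p) :=
      ⟨_, rfl⟩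
    have hSp : ∀ k, S (p + k) = S k + 1 := by
      intro k; rw [hS]; exact S_add p γ h k
    have hX : ∀ k : ℕ, S ((k : ZMod (2 * p)).val) = S k := by
      intro k; rw [ZMod.val_natCast, hS]; exact S_per p γ h k
    have hSs : ∀ k, S k + S (k + 1) = γ (k : ZMod p) := by
      intro k; rw [hS]; simp only [Finset.sum_range_succ]; exact two _ _
    have hD : ∀ j : ZMod (2 * p), S j.val + S (j + 1).val =
          γ (ZMod.castHom (dvd_mul_left p 2) (ZMod p) j) := by
      intro j
      obtain ⟨k, rfl⟩ := ZMod.natCast_zmod_surjective j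
      have := hX (k + 1)
      push_cast at this
      rw [this, hX, hSs, map_natCast]
    refine ⟨fun i => S i.val, fun j => S j.val, ?_, ?_, hD⟩
    · intro i hi
      have e : S ((i : ZMod p).val) = S i := by rw [ZMod.val_natCast, Nat.mod_eq_of_lt hi]
      refine ⟨(hX i).trans e.symm, ?_⟩
      change S (((p + i : ℕ) : ZMod (2 * p)).val) = S ((i : ZMod p).val) + 1
      rw [hX, hSp, e]
    · intro a b hab
      have hab' : ∀ t : ℕ, t < n → S (a + (t : ZMod (2 * p))).val = S (b + (t : ZMod (2 * p))).val :=
        fun t ht => congrFun hab ⟨t, ht⟩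
      have hg : ZMod.castHom (dvd_mul_left p 2) (ZMod p) a
          = ZMod.castHom (dvd_mul_left p 2) (ZMod p) b := by
        apply hΓ
        funext t
        have h1 := hab' t (by omega)
        have h2 := hab' (t + 1) (by omega)
        push_cast at h2
        rw [← add_assoc, ← add_assoc] at h2
        have ha := hD (a + ((t : ℕ) : ZMod (2 * p)))
        have hb := hD (b + ((t : ℕ) : ZMod (2 * p)))
        rw [h1, h2, hb, map_add, map_add, map_natCast] at ha
        exact ha.symm
      have h0 := hab' 0 (by omega)
      simp only [Nat.cast_zero, add_zero] at h0
      have hm : a.val % p = b.val % p := by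
        rw [← ZMod.natCast_zmod_val a, ← ZMod.natCast_zmod_val b, map_natCast, map_natCast,
          ZMod.natCast_eq_natCast_iff'] at hg
        exact hg
      have la := ZMod.val_lt a
      have lb := ZMod.val_lt b
      have ne : ∀ s : ZMod 2, s + 1 ≠ s := by decide
      apply ZMod.val_injective
      have da := Nat.mod_add_div a.val p
      have db := Nat.mod_add_div b.val p
      have qa : a.val / p < 2 := Nat.div_lt_of_lt_mul (by linarith)
      have qb : b.val / p < 2 := Nat.div_lt_of_lt_mul (by linarith)
      generalize a.val / p = u at *
      generalize b.val / p = v at *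
      rcases Nat.lt_trichotomy (u) (v) with hl | hl | hl
      · exfalso
        have e1 : u = 0 := by omega
        have e2 : v = 1 := by omega
        rw [e1] at da
        rw [e2] at db
        have : b.val = p + a.val := by omega
        rw [this, hSp] at h0
        exact ne _ h0.symm
      · rw [← da, ← db, hm, hl]
      · exfalso
        have e1 : u = 1 := by omega
        have e2 : v = 0 := by omega
        rw [e1] at da
        rw [e2] at db
        have : a.val = p + b.val := by omega
        rw [this, hSp] at h0
        exact ne _ h0
  · rintro ⟨x, X, hx, -, hD⟩
    have key : ∀ k : ℕ, ∑ i ∈ Finset.range k, γ (i : ZMod p)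
        = X ((0 : ℕ) : ZMod (2 * p)) + X (k : ZMod (2 * p)) := by
      intro k
      induction k with
      | zero => simp only [Finset.range_zero, Finset.sum_empty]; exact (CharTwo.add_self_eq_zero _).symm
      | succ k ih =>
        have := hD (k : ZMod (2 * p))
        rw [map_natCast] at this
        rw [Finset.sum_range_succ, ih, ← this, add_assoc, two]
        push_cast
        rfl
    have h0 := hx 0 hp
    have hw : weight p γ = _ := key p
    rw [hw, h0.1]
    have h2 := h0.2
    rw [add_zero] at h2
    rw [h2, two]

end DeBruijn
end

section
/- Let n ≥ 1. A function d : (ZMod 2)^2 → ZMod 2 induces a sliding-window homomorphism D_{n,1} from B_{n+1}(2) to B_n(2) with property (D) if and only if d(x_1,x_2) = x_1 + x_2 for all x, or d(x_1,x_2) = x_1 + x_2 + 1 for all x. -/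
namespace DeBruijn

theorem suff (n : ℕ) (hn : 1 ≤ n) (d : (Fin 2 → ZMod 2) → ZMod 2) (e : ZMod 2)
    (h : ∀ x : Fin 2 → ZMod 2, d x = x 0 + x 1 + e) : PropertyD 2 n 1 d := by
  have z1 : ∀ a b c e : ZMod 2, a + b + e = c → b = a + (c + e) := by decide
  have z2 : ∀ a c e : ZMod 2, a + (a + (c + e)) + e = c := by decide
  intro l hl c hc
  have step : ∀ w x, IsLift n d c w x → ∀ j (hj : j < l + n - 1),
      x ⟨j, by omega⟩ + x ⟨j + 1, by omega⟩ + e = c (j : ZMod l) := by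
    intro w x hx j hj
    have := hx.2 j hj
    rw [h] at this
    exact this
  refine ⟨?_, ?_⟩
  · intro w
    refine ⟨fun j => w 0 + ∑ i ∈ Finset.range j, (c (i : ZMod l) + e), ⟨?_, ?_⟩, ?_⟩
    · intro j
      fin_cases j
      simp
    · intro j hj
      rw [h]
      change w 0 + ∑ i ∈ Finset.range j, (c (i : ZMod l) + e) +
        (w 0 + ∑ i ∈ Finset.range (j + 1), (c (i : ZMod l) + e)) + e = _
      rw [Finset.sum_range_succ, ← add_assoc (w 0)]
      exact z2 _ _ _
    · intro y hy
      have : ∀ j (hj : j < l + n - 1 + 1),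
          y ⟨j, hj⟩ = w 0 + ∑ i ∈ Finset.range j, (c (i : ZMod l) + e) := by
        intro j
        induction j with
        | zero => intro hj; simpa using hy.1 0
        | succ j ih =>
          intro hj
          rw [z1 _ _ _ _ (step w y hy j (by omega)), ih (by omega), Finset.sum_range_succ, add_assoc]
      funext j
      exact this j j.isLt
  · intro w w' x x' hx hx' j j' hv
    have hv' : ∀ t (ht : t < n + 1), x ⟨j + t, by omega⟩ = x' ⟨j' + t, by omega⟩ :=
      fun t ht => congrFun hv ⟨t, ht⟩
    have hjj : j = j' := by
      have : ((j : ℕ) : ZMod l) = ((j' : ℕ) : ZMod l) := by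
        apply hc
        funext t
        have ht := t.isLt
        have a := step w x hx (j + t) (by omega)
        have b := step w' x' hx' (j' + t) (by omega)
        have p := hv' t (by omega)
        have q := hv' (t + 1) (by omega)
        simp only [← add_assoc] at q
        rw [p, q, b] at a
        simpa [cycleVertex] using a.symm
      rw [ZMod.natCast_eq_natCast_iff'] at this
      rw [Nat.mod_eq_of_lt j.isLt, Nat.mod_eq_of_lt j'.isLt] at this
      exact Fin.ext this
    subst hjj
    refine ⟨?_, rfl⟩
    have back : ∀ i (hi : i < l + n - 1 + 1), x ⟨i, hi⟩ = x' ⟨i, hi⟩ →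
        x ⟨0, by omega⟩ = x' ⟨0, by omega⟩ := by
      intro i
      induction i with
      | zero => intro _ h; exact h
      | succ i ih =>
        intro hi hxx
        apply ih (by omega)
        have a := step w x hx i (by omega)
        have b := step w' x' hx' i (by omega)
        rw [← b, hxx] at a
        exact add_right_cancel (add_right_cancel a)
    have := back j (by omega) (hv' 0 (by omega))
    funext i
    rw [Subsingleton.elim i 0]
    rw [← hx.1 0, ← hx'.1 0]
    exact this

/-- A function `d : (ZMod 2)² → ZMod 2` induces a sliding-window
homomorphism from `B_{n+1}(2)` to `B_n(2)` with property (D) iff `d` is Lempel's D-morphism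
`x₁ + x₂` or its complement `x₁ + x₂ + 1`. -/
theorem stmt12 (n : ℕ) (hn : 1 ≤ n) (d : (Fin 2 → ZMod 2) → ZMod 2) :
    PropertyD 2 n 1 d ↔
      ((∀ x : Fin 2 → ZMod 2, d x = x 0 + x 1) ∨
       (∀ x : Fin 2 → ZMod 2, d x = x 0 + x 1 + 1)) := by
  constructor
  · intro h
    have hs : ∀ a s : ZMod 2, ∃ b, d ![a, b] = s := by
      intro a s
      have h1 := (h 1 one_pos (fun _ => s) (by
        intro i j _
        exact Subsingleton.elim (α := Fin 1) i j)).1 (fun _ => a)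
      obtain ⟨x, ⟨hx0, hx1⟩, -⟩ := h1
      refine ⟨x ⟨1, by omega⟩, ?_⟩
      have := hx1 0 (by omega)
      refine Eq.trans ?_ this
      congr 1
      funext t
      fin_cases t
      · exact (hx0 0).symm
      · rfl
    have key : ∀ e : ZMod 2, ¬ ∀ x : Fin 2 → ZMod 2, d x = x 1 + e := by
      intro e he
      have h2 := h 2 two_pos (fun i : ZMod 2 => (i : ZMod 2)) (by
        intro i j hij
        have := congrFun hij ⟨0, by omega⟩
        simpa [cycleVertex] using this)
      obtain ⟨x, hx, -⟩ := h2.1 (fun _ => 0)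
      obtain ⟨y, hy, -⟩ := h2.1 (fun _ => 1)
      have h3 := (h2.2 _ _ x y hx hy 1 1 (by
        funext t
        have a := hx.2 t (by have := t.isLt; omega)
        have b := hy.2 t (by have := t.isLt; omega)
        rw [← b, he, he] at a
        have a' := add_right_cancel a
        have e1 : (⟨((1 : Fin 2) : ℕ) + t, by have := t.isLt; simp; omega⟩ : Fin (2 + n - 1 + 1))
          = ⟨(t : ℕ) + ((1 : Fin 2) : ℕ), by have := t.isLt; simp; omega⟩ := by
          ext; simp; omega
        simp only [liftVertex]
        rw [e1]
        exact a')).1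
      exact absurd (congrFun h3 0) (by decide)
    have hd : ∀ x : Fin 2 → ZMod 2, d x = d ![x 0, x 1] := by
      intro x
      congr 1
      funext t
      fin_cases t <;> rfl
    have gen : ∀ f : ZMod 2 → ZMod 2 → ZMod 2, (∀ a s, ∃ b, f a b = s) →
        (∀ e, ¬ ∀ a b, f a b = b + e) →
        (∀ a b, f a b = a + b) ∨ (∀ a b, f a b = a + b + 1) := by
      decide
    rcases gen (fun a b => d ![a, b]) hs (fun e he => key e (fun x => by rw [hd]; exact he _ _)) with g | g
    · left; intro x; rw [hd]; exact g _ _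
    · right; intro x; rw [hd]; exact g _ _
  · rintro (h | h)
    · exact suff n hn d 0 (by simpa using h)
    · exact suff n hn d 1 h

end DeBruijn
end

section
/- Let n ≥ 1. A function d : (ZMod 2)^3 → ZMod 2 induces a sliding-window homomorphism D_{n,2} from B_{n+2}(2) to B_n(2) with property (D) if and only if d is one of the four functions (x_1,x_2,x_3) ↦ x_1 + x_3, x_1 + x_3 + 1, x_1 + x_2 + x_3, or x_1 + x_2 + x_3 + 1. -/
namespace DeBruijn

theorem lift_eqs {n l : ℕ} {d : (Fin 3 → ZMod 2) → ZMod 2} {f : ZMod 2 → ZMod 2}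
    (hd : ∀ x, d x = x 0 + x 2 + f (x 1)) {c : ZMod l → ZMod 2} {w : Fin 2 → ZMod 2}
    {x : Fin (l + n - 1 + 2) → ZMod 2} (hx : IsLift n (k := 2) d c w x) (j : ℕ)
    (hj : j < l + n - 1) :
    x ⟨j, by omega⟩ + x ⟨j + 2, by omega⟩ + f (x ⟨j + 1, by omega⟩) = c (j : ZMod l) := by
  have := hx.2 j hj
  rw [hd] at this
  exact this

theorem zcancel : ∀ a b b' e : ZMod 2, a + b + e = a + b' + e → b = b' := by decide

theorem zcancel' : ∀ a b b' e : ZMod 2, b + a + e = b' + a + e → b = b' := by decide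

theorem zsolve : ∀ a u e : ZMod 2, a + (u + a + e) + e = u := by decide

theorem zdich : ∀ a b c : ZMod 2, a ≠ b → c = a ∨ c = b := by decide

/-- Two strings with equal windows that agree at two consecutive places agree after them. -/
theorem agree_fwd {N : ℕ} {d : (Fin 3 → ZMod 2) → ZMod 2}
    (hp : ∀ a b u v, d ![a, b, u] = d ![a, b, v] → u = v)
    {x y : Fin (N + 2) → ZMod 2}
    (h : ∀ j : ℕ, (hj : j < N) →
      d ![x ⟨j, by omega⟩, x ⟨j + 1, by omega⟩, x ⟨j + 2, by omega⟩] =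
      d ![y ⟨j, by omega⟩, y ⟨j + 1, by omega⟩, y ⟨j + 2, by omega⟩])
    (m : ℕ) (hm : m + 1 < N + 2) (h0 : x ⟨m, by omega⟩ = y ⟨m, by omega⟩)
    (h1 : x ⟨m + 1, by omega⟩ = y ⟨m + 1, by omega⟩) :
    ∀ k : ℕ, (hk : m + k + 1 < N + 2) → x ⟨m + k, by omega⟩ = y ⟨m + k, by omega⟩ ∧
      x ⟨m + k + 1, by omega⟩ = y ⟨m + k + 1, by omega⟩ := by
  intro k
  induction k with
  | zero => intro _; exact ⟨h0, h1⟩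
  | succ k ih =>
    intro hk
    obtain ⟨a, b⟩ := ih (by omega)
    refine ⟨b, ?_⟩
    have := h (m + k) (by omega)
    rw [a, b] at this
    exact hp _ _ _ _ this

theorem win_s13 {n l : ℕ} {d : (Fin 3 → ZMod 2) → ZMod 2}
    {c : ZMod l → ZMod 2} {w : Fin 2 → ZMod 2}
    {x : Fin (l + n - 1 + 2) → ZMod 2} (hx : IsLift n (k := 2) d c w x) (j : ℕ)
    (hj : j < l + n - 1) :
    d ![x ⟨j, by omega⟩, x ⟨j + 1, by omega⟩, x ⟨j + 2, by omega⟩] = c (j : ZMod l) := by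
  rw [← hx.2 j hj]
  congr 1
  funext t
  fin_cases t <;> rfl

theorem propD_of_form (n : ℕ) (hn : 1 ≤ n) (d : (Fin 3 → ZMod 2) → ZMod 2)
    (f : ZMod 2 → ZMod 2) (hd : ∀ x, d x = x 0 + x 2 + f (x 1)) : PropertyD 2 n 2 d := by
  have hp : ∀ a b u v, d ![a, b, u] = d ![a, b, v] → u = v := by
    intro a b u v h
    rw [hd, hd] at h
    exact zcancel _ _ _ _ h
  intro l hl c hc
  have huniq : ∀ (w : Fin 2 → ZMod 2) (x y : Fin (l + n - 1 + 2) → ZMod 2),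
      IsLift n (k := 2) d c w x → IsLift n (k := 2) d c w y → x = y := by
    intro w x y hx hy
    have key := agree_fwd hp (x := x) (y := y)
      (fun j hj => (win_s13 hx j hj).trans (win_s13 hy j hj).symm) 0 (by omega)
      ((hx.1 0).trans (hy.1 0).symm) ((hx.1 1).trans (hy.1 1).symm)
    funext i
    obtain ⟨i, hi⟩ := i
    rcases i with _ | i
    · exact (hx.1 0).trans (hy.1 0).symm
    · have := (key i (by omega)).2
      simpa using this
  refine ⟨fun w => ?_, ?_⟩
  · let g : ℕ → ZMod 2 × ZMod 2 := fun j => Nat.rec (w 0, w 1)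
      (fun j p => (p.2, c (j : ZMod l) + p.1 + f p.2)) j
    have hg : ∀ j, g (j + 1) = ((g j).2, c (j : ZMod l) + (g j).1 + f (g j).2) := fun j => rfl
    refine ⟨fun i => (g i).1, ⟨?_, ?_⟩, fun y hy => huniq w _ _ hy ⟨?_, ?_⟩⟩
    all_goals first
      | (intro j; fin_cases j <;> rfl)
      | (intro j hj
         rw [hd]
         change (g j).1 + (g (j + 2)).1 + f (g (j + 1)).1 = _
         rw [hg (j + 1), hg j]
         exact zsolve _ _ _)
  · intro w w' x x' hx hx' j j' h
    have hv : ∀ t : ℕ, (ht : t < n + 2) → x ⟨j + t, by omega⟩ = x' ⟨j' + t, by omega⟩ :=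
      fun t ht => congrFun h ⟨t, ht⟩
    have hj : ((j : ℕ) : ZMod l) = ((j' : ℕ) : ZMod l) := by
      apply hc
      funext t
      have ht := t.isLt
      have e1 := win_s13 hx (j + t) (by omega)
      have e2 := win_s13 hx' (j' + t) (by omega)
      have a0 := hv t (by omega)
      have a1 := hv (t + 1) (by omega)
      have a2 := hv (t + 2) (by omega)
      simp only [← add_assoc] at a1 a2
      rw [a0, a1, a2, e2] at e1
      simp only [cycleVertex]
      push_cast at e1
      exact e1.symm
    have hjj : j = j' := by
      have := (ZMod.natCast_eq_natCast_iff' _ _ _).1 hj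
      rw [Nat.mod_eq_of_lt j.isLt, Nat.mod_eq_of_lt j'.isLt] at this
      exact Fin.ext this
    refine ⟨?_, hjj⟩
    subst hjj
    have back : ∀ m : ℕ, (hm : m + 1 < l + n - 1 + 2) →
        x ⟨m, by omega⟩ = x' ⟨m, by omega⟩ → x ⟨m + 1, by omega⟩ = x' ⟨m + 1, by omega⟩ →
        x ⟨0, by omega⟩ = x' ⟨0, by omega⟩ ∧ x ⟨1, by omega⟩ = x' ⟨1, by omega⟩ := by
      intro m
      induction m with
      | zero => intro _ a b; exact ⟨a, b⟩
      | succ m ih =>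
        intro hm a b
        refine ih (by omega) ?_ a
        have e1 := lift_eqs hd hx m (by omega)
        have e2 := lift_eqs hd hx' m (by omega)
        rw [a, b, ← e2] at e1
        exact zcancel' _ _ _ _ e1
    have := back j (by omega) (hv 0 (by omega)) (hv 1 (by omega))
    funext t
    fin_cases t
    · exact (hx.1 0).symm.trans (this.1.trans (hx'.1 0))
    · exact (hx.1 1).symm.trans (this.2.trans (hx'.1 1))

theorem form_of_propD (n : ℕ) (hn : 1 ≤ n) (d : (Fin 3 → ZMod 2) → ZMod 2)
    (h : PropertyD 2 n 2 d) : ∃ f : ZMod 2 → ZMod 2, ∀ x, d x = x 0 + x 2 + f (x 1) := by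
  have hs : ∀ a b v, ∃ u, d ![a, b, u] = v := by
    intro a b v
    have hc : VertexDisjoint n (fun _ : ZMod 1 => v) := fun i j _ => Subsingleton.elim i j
    obtain ⟨x, hx, -⟩ := (h 1 one_pos _ hc).1 ![a, b]
    refine ⟨x ⟨2, by omega⟩, ?_⟩
    have e := win_s13 hx 0 (by omega)
    have e0 : x ⟨0, by omega⟩ = a := hx.1 0
    have e1 : x ⟨1, by omega⟩ = b := hx.1 1
    simp only [zero_add] at e
    rw [e0, e1] at e
    exact e
  have hp : ∀ a b u v, d ![a, b, u] = d ![a, b, v] → u = v := by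
    intro a b
    have : Function.Surjective (fun u => d ![a, b, u]) := fun v => hs a b v
    have := Finite.injective_iff_surjective.2 this
    exact fun u v e => this e
  have hl : ∀ b t, d ![0, b, t] ≠ d ![1, b, t] := by
    intro b t e
    have hc : VertexDisjoint n (fun i : ZMod 2 => i + d ![0, b, t]) := by
      intro i j hij
      have := congrFun hij ⟨0, hn⟩
      simpa [cycleVertex] using this
    obtain ⟨hE, hD⟩ := h 2 two_pos _ hc
    obtain ⟨x, hx, -⟩ := hE ![0, b]
    obtain ⟨y, hy, -⟩ := hE ![1, b]
    have x0 : x ⟨0, by omega⟩ = 0 := hx.1 0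
    have x1 : x ⟨1, by omega⟩ = b := hx.1 1
    have y0 : y ⟨0, by omega⟩ = 1 := hy.1 0
    have y1 : y ⟨1, by omega⟩ = b := hy.1 1
    have ex := win_s13 hx 0 (by omega)
    have ey := win_s13 hy 0 (by omega)
    simp only [zero_add, Nat.cast_zero] at ex ey
    rw [x0, x1] at ex
    rw [y0, y1, e] at ey
    have x2 := hp _ _ _ _ ex
    have y2 := hp _ _ _ _ ey
    have key := agree_fwd hp (x := x) (y := y)
      (fun j hj => by
        rcases j with _ | j
        · simp only [zero_add]
          rw [x0, x1, y0, y1, x2, y2, e]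
        · exact (win_s13 hx _ hj).trans (win_s13 hy _ hj).symm) 1 (by omega)
      (x1.trans y1.symm) (x2.trans y2.symm)
    have := (hD _ _ x y hx hy 1 1 (by
      funext t
      have ht := t.isLt
      rcases Nat.eq_zero_or_pos t.val with h0 | h0
      · have := (key 0 (by omega)).1
        simp only [liftVertex, h0]
        exact this
      · have := (key (t - 1) (by omega)).2
        have e3 : 1 + (t.val - 1) + 1 = 1 + t.val := by omega
        simp only [e3] at this
        exact this)).1
    have := congrFun this 0
    simp at this
  refine ⟨fun b => d ![0, b, 0], fun x => ?_⟩
  have ex : x = ![x 0, x 1, x 2] := by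
    funext t; fin_cases t <;> rfl
  rw [ex]
  simp only [Matrix.cons_val]
  generalize x 0 = a
  generalize x 1 = b
  generalize x 2 = u
  have h1 := hl b 0
  have h2 := hl b 1
  have h3 : d ![0, b, 0] ≠ d ![0, b, 1] := fun e => absurd (hp _ _ _ _ e) (by decide)
  have h4 : d ![1, b, 0] ≠ d ![1, b, 1] := fun e => absurd (hp _ _ _ _ e) (by decide)
  have ne1 : ∀ p q : ZMod 2, p ≠ q → q = 1 + p := by decide
  have fin : ∀ p q r s : ZMod 2, p ≠ q → r ≠ s → p ≠ r → q ≠ s →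
      q = 1 + 0 + p ∧ r = 0 + 1 + p ∧ s = 1 + 1 + p ∧ p = 0 + 0 + p := by
    intro p q r s h1 h2 h3 h4
    have e1 := ne1 _ _ h1
    have e2 := ne1 _ _ h3
    have e3 := ne1 _ _ h2
    refine ⟨by rw [e1]; ring, by rw [e2]; ring, by rw [e3, e2]; ring, by ring⟩
  obtain ⟨A, B, C, E⟩ := fin _ _ _ _ h1 h2 h3 h4
  have z : ∀ v : ZMod 2, v = 0 ∨ v = 1 := by decide
  rcases z a with rfl | rfl <;> rcases z u with rfl | rfl <;> assumption

/-- A function `d : (ZMod 2)³ → ZMod 2` induces a sliding-window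
homomorphism from `B_{n+2}(2)` to `B_n(2)` with property (D) iff `d` is one of the four
functions `x₁+x₃`, `x₁+x₃+1`, `x₁+x₂+x₃`, `x₁+x₂+x₃+1`. -/
theorem stmt13 (n : ℕ) (hn : 1 ≤ n) (d : (Fin 3 → ZMod 2) → ZMod 2) :
    PropertyD 2 n 2 d ↔
      ((∀ x : Fin 3 → ZMod 2, d x = x 0 + x 2) ∨
       (∀ x : Fin 3 → ZMod 2, d x = x 0 + x 2 + 1) ∨
       (∀ x : Fin 3 → ZMod 2, d x = x 0 + x 1 + x 2) ∨
       (∀ x : Fin 3 → ZMod 2, d x = x 0 + x 1 + x 2 + 1)) := by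
  constructor
  · intro h
    obtain ⟨f, hf⟩ := form_of_propD n hn d h
    have key : ∀ p q : ZMod 2,
        ((∀ a b c : ZMod 2, a + c + (if b = 0 then p else q) = a + c) ∨
        (∀ a b c : ZMod 2, a + c + (if b = 0 then p else q) = a + c + 1) ∨
        (∀ a b c : ZMod 2, a + c + (if b = 0 then p else q) = a + b + c) ∨
        (∀ a b c : ZMod 2, a + c + (if b = 0 then p else q) = a + b + c + 1)) := by decide
    have hf' : ∀ b, f b = if b = 0 then f 0 else f 1 := by
      intro b
      have z : ∀ v : ZMod 2, v = 0 ∨ v = 1 := by decide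
      rcases z b with rfl | rfl <;> simp
    have hg : ∀ x, d x = x 0 + x 2 + (if x 1 = 0 then f 0 else f 1) := fun x => by
      rw [hf, hf' (x 1)]
    rcases key (f 0) (f 1) with k | k | k | k
    · exact Or.inl fun x => (hg x).trans (k _ _ _)
    · exact Or.inr (Or.inl fun x => (hg x).trans (k _ _ _))
    · exact Or.inr (Or.inr (Or.inl fun x => (hg x).trans (k _ _ _)))
    · exact Or.inr (Or.inr (Or.inr fun x => (hg x).trans (k _ _ _)))
  · rintro (h | h | h | h)
    · exact propD_of_form n hn d (fun _ => 0) fun x => by rw [h]; ring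
    · exact propD_of_form n hn d (fun _ => 1) fun x => by rw [h]
    · exact propD_of_form n hn d (fun b => b) fun x => by rw [h]; ring
    · exact propD_of_form n hn d (fun b => b + 1) fun x => by rw [h]; ring

end DeBruijn
end

section
/- Let q ≥ 2, n ≥ 1, k ≥ 1 and let d : (ZMod q)^{k+1} → ZMod q induce a sliding-window homomorphism D_{n,k} from B_{n+k}(q) to B_n(q) that has property (D). Let Γ be a vertex-disjoint cycle of length l in B_n(q) with vertex set V ⊆ (ZMod q)^n. Then the preimage D_{n,k}^{−1}(V) ⊆ (ZMod q)^{n+k} has exactly l·q^k elements and is the disjoint union of the vertex sets of finitely many pairwise vertex-disjoint cycles of B_{n+k}(q), each of which is mapped by D_{n,k} onto Γ (each such cycle has length a multiple of l, and the symbol sequence of its D_{n,k}-image is a repeated traversal of the symbol sequence of Γ). -/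
namespace DeBruijn

section helpers

theorem right_surj (q n k : ℕ) (hn : 1 ≤ n)
    (d : (Fin (k + 1) → ZMod q) → ZMod q) (hd : PropertyD q n k d)
    (w : Fin k → ZMod q) (a : ZMod q) :
    ∃ y : ZMod q, d (Fin.snoc (α := fun _ => ZMod q) w y) = a := by
  have h := hd 1 one_pos (fun _ => a) (fun _ _ _ => Subsingleton.elim _ _)
  obtain ⟨x, hx, -⟩ := h.1 w
  refine ⟨x ⟨k, by omega⟩, ?_⟩
  refine Eq.trans ?_ (hx.2 0 (by omega))
  congr 1
  funext t
  refine Fin.lastCases ?_ (fun t => ?_) t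
  · simp
  · simp only [Fin.snoc_castSucc]
    rw [← hx.1 t]
    simp

theorem right_inj (q n k : ℕ) [NeZero q] (hn : 1 ≤ n)
    (d : (Fin (k + 1) → ZMod q) → ZMod q) (hd : PropertyD q n k d)
    (w : Fin k → ZMod q) (y y' : ZMod q)
    (h : d (Fin.snoc (α := fun _ => ZMod q) w y) = d (Fin.snoc (α := fun _ => ZMod q) w y')) :
    y = y' := by
  have hs : Function.Surjective (fun y => d (Fin.snoc (α := fun _ => ZMod q) w y)) :=
    fun a => right_surj q n k hn d hd w a
  exact (Finite.injective_iff_surjective.2 hs) h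

/-- state transition -/
def stp {A I : Type} {k : ℕ} (g : (Fin k → A) → A → A) (nx : I → I) (e : I → A)
    (s : I × (Fin k → A)) : I × (Fin k → A) :=
  (nx s.1, Fin.tail (Fin.snoc (α := fun _ => A) s.2 (g s.2 (e s.1))))

/-- symbol sequence -/
def sq {A I : Type} {k : ℕ} (hk : 1 ≤ k) (g : (Fin k → A) → A → A) (nx : I → I) (e : I → A)
    (s : I × (Fin k → A)) (j : ℕ) : A := ((stp g nx e)^[j] s).2 ⟨0, hk⟩

variable {A I : Type} {k : ℕ} (hk : 1 ≤ k) (g : (Fin k → A) → A → A) (nx : I → I) (e : I → A)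

theorem stp_shift (s : I × (Fin k → A)) (t : ℕ) (ht : t + 1 < k) :
    (stp g nx e s).2 ⟨t, by omega⟩ = s.2 ⟨t + 1, ht⟩ := by
  simp [stp, Fin.tail, Fin.snoc, ht]

theorem stp_last (s : I × (Fin k → A)) :
    (stp g nx e s).2 ⟨k - 1, by omega⟩ = g s.2 (e s.1) := by
  have : ¬ (k - 1 + 1 < k) := by omega
  simp [stp, Fin.tail, Fin.snoc, this]

theorem sq_lt (t : ℕ) : ∀ (s : I × (Fin k → A)) (ht : t < k), sq hk g nx e s t = s.2 ⟨t, ht⟩ := by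
  induction t with
  | zero => intro s ht; rfl
  | succ t ih =>
    intro s ht
    have := ih (stp g nx e s) (by omega)
    rw [stp_shift _ _ _ _ _ ht] at this
    rw [← this]
    simp [sq]

theorem sq_add (s : I × (Fin k → A)) (i j : ℕ) :
    sq hk g nx e s (i + j) = sq hk g nx e ((stp g nx e)^[i] s) j := by
  rw [sq, sq, add_comm, Function.iterate_add_apply]

theorem sq_k (s : I × (Fin k → A)) : sq hk g nx e s k = g s.2 (e s.1) := by
  have h := sq_add hk g nx e s 1 (k-1)
  rw [show 1 + (k-1) = k by omega, sq_lt hk g nx e (k-1) _ (by omega)] at h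
  rw [h]
  exact stp_last hk g nx e s

theorem sq_snoc (s : I × (Fin k → A)) :
    (fun t : Fin (k+1) => sq hk g nx e s t) =
      Fin.snoc (α := fun _ => A) s.2 (g s.2 (e s.1)) := by
  funext t
  refine Fin.lastCases ?_ (fun t => ?_) t
  · simp [sq_k]
  · simp [sq_lt hk g nx e t s t.isLt]

theorem sq_win (d : (Fin (k + 1) → A) → A)
    (hg : ∀ w a, d (Fin.snoc (α := fun _ => A) w (g w a)) = a) (s : I × (Fin k → A)) (i : ℕ) :
    d (fun t => sq hk g nx e s (i + t)) = e (nx^[i] s.1) := by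
  simp only [sq_add]
  rw [sq_snoc, hg]
  congr 1
  induction i generalizing s with
  | zero => rfl
  | succ i ih => simp only [Function.iterate_succ_apply, ih]; rfl

end helpers

theorem left_inj (q n k : ℕ) (hq : 2 ≤ q) (hn : 1 ≤ n) (hk : 1 ≤ k)
    (d : (Fin (k + 1) → ZMod q) → ZMod q) (hd : PropertyD q n k d)
    (z : Fin k → ZMod q) (u u' : ZMod q)
    (h : d (Fin.cons (α := fun _ => ZMod q) u z) = d (Fin.cons (α := fun _ => ZMod q) u' z)) :
    u = u' := by
  have : Fact (1 < q) := ⟨hq⟩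
  obtain ⟨a, ha⟩ : ∃ a, a = d (Fin.cons (α := fun _ => ZMod q) u z) := ⟨_, rfl⟩
  obtain ⟨b, hb⟩ := exists_ne a
  choose g hg using right_surj q n k hn d hd
  let c : ZMod (n+1) → ZMod q := fun p => if p = (n : ZMod (n+1)) then b else a
  have hn0 : (0 : ZMod (n+1)) ≠ (n : ZMod (n+1)) := by
    intro h0
    have h1 := (ZMod.natCast_eq_zero_iff n (n+1)).1 h0.symm
    have := Nat.le_of_dvd (by omega) h1
    omega
  have key : ∀ p p' : ZMod (n+1), cycleVertex n c p = cycleVertex n c p' → p ≠ 0 → p = p' := by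
    intro p p' hpp hp
    have hv : p.val ≠ 0 := by rwa [Ne, ZMod.val_eq_zero]
    have hlt := ZMod.val_lt p
    have h1 := congrFun hpp ⟨n - p.val, by omega⟩
    have h2 : p + ((n - p.val : ℕ) : ZMod (n+1)) = (n : ZMod (n+1)) := by
      conv_lhs => lhs; rw [← ZMod.natCast_zmod_val p]
      rw [← Nat.cast_add]
      congr 1
      omega
    simp only [cycleVertex, c, h2, if_true] at h1
    by_cases h3 : p' + ((n - p.val : ℕ) : ZMod (n+1)) = (n : ZMod (n+1))
    · exact add_right_cancel (h2.trans h3.symm)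
    · rw [if_neg h3] at h1
      exact absurd h1 hb
  have hc : VertexDisjoint n c := by
    intro p p' hpp
    by_cases hp : p = 0
    · by_cases hp' : p' = 0
      · rw [hp, hp']
      · exact (key p' p hpp.symm hp').symm
    · exact key p p' hpp hp
  let x : ℕ → ZMod q := sq hk g Nat.succ (fun j : ℕ => c ((j + 1 : ℕ) : ZMod (n+1))) (0, z)
  have hx0 : ∀ t : Fin k, x t = z t := fun t => sq_lt hk _ _ _ t _ t.isLt
  have hxw : ∀ i, d (fun t => x (i + t)) = c ((i + 1 : ℕ) : ZMod (n+1)) := by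
    intro i
    have := sq_win hk g Nat.succ (fun j : ℕ => c ((j + 1 : ℕ) : ZMod (n+1))) d hg (0, z) i
    simpa [x, Nat.succ_iterate] using this
  let y : ZMod q → ℕ → ZMod q := fun v j => Nat.casesOn j v x
  have hlift : ∀ v, a = d (Fin.cons (α := fun _ => ZMod q) v z) →
      IsLift n d c (fun j => y v j) (fun j : Fin (n + 1 + n - 1 + k) => y v j) := by
    intro v hv
    refine ⟨fun j => rfl, fun j hj => ?_⟩
    cases j with
    | zero =>
      have : c ((0 : ℕ) : ZMod (n+1)) = a := by
        simp only [c, Nat.cast_zero, if_neg hn0]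
      rw [this, hv]
      congr 1
      funext t
      refine Fin.cases ?_ (fun t => ?_) t
      · simp [y]
      · simp [y, hx0]
    | succ j =>
      rw [← hxw j]
      congr 1
      funext t
      show y v (j + 1 + t) = _
      rw [show j + 1 + (t:ℕ) = (j + t) + 1 by omega]
  have hfin := (hd (n+1) (by omega) c hc).2 _ _ _ _ (hlift u ha) (hlift u' (ha.trans h))
    ⟨1, by omega⟩ ⟨1, by omega⟩ (by
      funext t
      show y u (1 + t) = y u' (1 + t)
      rw [add_comm])
  exact congrFun hfin.1 ⟨0, hk⟩

/-- If the sliding-window homomorphism `D_{n,k}` induced by `d` has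
property (D) and `Γ` is a vertex-disjoint cycle of length `l` in `B_n(q)` with vertex set
`V`, then `D_{n,k}⁻¹(V)` has exactly `l·q^k` elements and is the disjoint union of the vertex
sets of finitely many pairwise vertex-disjoint cycles of `B_{n+k}(q)`, each of length a
multiple of `l` and each mapped by `D_{n,k}` onto `Γ` (its image symbol sequence being a
repeated traversal of that of `Γ`). -/
theorem stmt15 (q n k l : ℕ) (hq : 2 ≤ q) (hn : 1 ≤ n) (hk : 1 ≤ k) (hl : 0 < l)
    (d : (Fin (k + 1) → ZMod q) → ZMod q) (hd : PropertyD q n k d)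
    (c : ZMod l → ZMod q) (hc : VertexDisjoint n c)
    (D : (Fin (n + k) → ZMod q) → Fin n → ZMod q)
    (hD : ∀ (x : Fin (n + k) → ZMod q) (i : Fin n),
      D x i = d (fun t => x ⟨(i : ℕ) + (t : ℕ), by have := i.isLt; have := t.isLt; omega⟩)) :
    (D ⁻¹' (Set.range (cycleVertex n c))).ncard = l * q ^ k ∧
    ∃ (m : ℕ) (L : Fin m → ℕ) (X : (s : Fin m) → ZMod (L s) → ZMod q),
      (∀ s, ∃ r : ℕ, 0 < r ∧ L s = r * l) ∧
      (∀ s, VertexDisjoint (n + k) (X s)) ∧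
      (∀ s s', s ≠ s' → Disjoint (Set.range (cycleVertex (n + k) (X s)))
        (Set.range (cycleVertex (n + k) (X s')))) ∧
      (⋃ s, Set.range (cycleVertex (n + k) (X s))) = D ⁻¹' (Set.range (cycleVertex n c)) ∧
      (∀ s, ∃ φ : ZMod (L s) → ZMod l,
        (∀ p, φ (p + 1) = φ p + 1) ∧
        (∀ p, d (fun t => X s (p + ((t : ℕ) : ZMod (L s)))) = c (φ p)) ∧
        (∀ p, D (cycleVertex (n + k) (X s) p) = cycleVertex n c (φ p))) := by
  have : NeZero q := ⟨by omega⟩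
  have : NeZero l := ⟨by omega⟩
  have hli := left_inj q n k hq hn hk d hd
  have hri := right_inj q n k hn d hd
  choose g hg using right_surj q n k hn d hd
  let S := ZMod l × (Fin k → ZMod q)
  let T : S → S := stp g (fun i => i + 1) c
  let x : S → ℕ → ZMod q := sq hk g (fun i => i + 1) c
  have hit : ∀ (i : ℕ) (p : ZMod l), (fun i : ZMod l => i + 1)^[i] p = p + i := by
    intro i p
    induction i with
    | zero => simp
    | succ i ih => rw [Function.iterate_succ_apply', ih]; push_cast; ring
  have hT1 : ∀ (i : ℕ) (s : S), (T^[i] s).1 = s.1 + i := by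
    intro i s
    induction i with
    | zero => simp
    | succ i ih =>
      rw [Function.iterate_succ_apply']
      show (T^[i] s).1 + 1 = _
      rw [ih]; push_cast; ring
  have hxw : ∀ (s : S) (i : ℕ), d (fun t => x s (i + t)) = c (s.1 + i) := by
    intro s i
    have := sq_win hk g (fun i => i + 1) c d hg s i
    rwa [hit] at this
  have hxadd : ∀ (s : S) (i j : ℕ), x s (i + j) = x (T^[i] s) j := sq_add hk g _ c
  have hx0 : ∀ (s : S) (t : Fin k), x s t = s.2 t := fun s t => sq_lt hk g _ c t s t.isLt
  have hTinj : Function.Injective T := by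
    rintro ⟨i, w⟩ ⟨i', w'⟩ h
    have h1 : i = i' := by
      have := congrArg Prod.fst h
      exact add_right_cancel this
    subst h1
    have h2 : Fin.tail (Fin.snoc (α := fun _ => ZMod q) w (g w (c i))) =
      Fin.tail (Fin.snoc (α := fun _ => ZMod q) w' (g w' (c i))) := congrArg Prod.snd h
    have h3 := (hg w (c i)).trans (hg w' (c i)).symm
    rw [← Fin.cons_self_tail (Fin.snoc (α := fun _ => ZMod q) w (g w (c i))),
      ← Fin.cons_self_tail (Fin.snoc (α := fun _ => ZMod q) w' (g w' (c i))), h2] at h3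
    have h4 := hli _ _ _ h3
    have h5 : (Fin.snoc (α := fun _ => ZMod q) w (g w (c i))) =
        (Fin.snoc (α := fun _ => ZMod q) w' (g w' (c i))) := by
      rw [← Fin.cons_self_tail (Fin.snoc (α := fun _ => ZMod q) w (g w (c i))),
        ← Fin.cons_self_tail (Fin.snoc (α := fun _ => ZMod q) w' (g w' (c i))), h2, h4]
    have h6 := congrArg (Fin.init (α := fun _ => ZMod q)) h5
    rw [Fin.init_snoc, Fin.init_snoc] at h6
    rw [h6]
  let word : S → Fin (n + k) → ZMod q := fun s j => x s j
  have hDw : ∀ s, D (word s) = cycleVertex n c s.1 := by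
    intro s
    funext i
    rw [hD]
    exact hxw s i
  have hwinj : Function.Injective word := by
    intro s s' h
    have h1 : s.1 = s'.1 := hc (by rw [← hDw, ← hDw, h])
    refine Prod.ext h1 ?_
    funext t
    rw [← hx0, ← hx0]
    exact congrFun h ⟨t, by have := t.isLt; omega⟩
  have hrange : Set.range word = D ⁻¹' (Set.range (cycleVertex n c)) := by
    ext v
    constructor
    · rintro ⟨s, rfl⟩
      exact ⟨s.1, (hDw s).symm⟩
    · rintro ⟨i, hi⟩
      let w : Fin k → ZMod q := fun t => v ⟨t, by have := t.isLt; omega⟩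
      refine ⟨(i, w), ?_⟩
      have main : ∀ j : ℕ, ∀ hj : j < n + k, x (i, w) j = v ⟨j, hj⟩ := by
        intro j
        induction j using Nat.strong_induction_on with
        | _ j ih =>
          intro hj
          by_cases hjk : j < k
          · exact hx0 (i, w) ⟨j, hjk⟩
          · obtain ⟨m, rfl⟩ : ∃ m, j = m + k := ⟨j - k, by omega⟩
            have hm : m < n := by omega
            have e1 := hxw (i, w) m
            have e2 := congrFun hi ⟨m, hm⟩
            rw [hD] at e2
            have e3 : d (fun t => x (i, w) (m + t)) = d (fun t => v ⟨m + t, by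
              have := t.isLt; omega⟩) := e1.trans e2
            have s1 : (fun t : Fin (k+1) => x (i, w) (m + t)) =
              Fin.snoc (α := fun _ => ZMod q)
                (fun t : Fin k => v ⟨m + t, by have := t.isLt; omega⟩) (x (i, w) (m + k)) := by
              funext t
              refine Fin.lastCases ?_ (fun t => ?_) t
              · simp
              · simp only [Fin.snoc_castSucc, Fin.val_castSucc]
                exact ih _ (by have := t.isLt; omega) _
            have s2 : (fun t : Fin (k+1) => v ⟨m + t, by have := t.isLt; omega⟩) =
              Fin.snoc (α := fun _ => ZMod q)
                (fun t : Fin k => v ⟨m + t, by have := t.isLt; omega⟩) (v ⟨m + k, hj⟩) := by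
              funext t
              refine Fin.lastCases ?_ (fun t => ?_) t
              · simp
              · simp only [Fin.snoc_castSucc, Fin.val_castSucc]
            rw [s1, s2] at e3
            exact hri _ _ _ e3
      funext j
      exact main j j.isLt
  refine ⟨?_, ?_⟩
  · rw [← hrange, ← Set.image_univ, Set.ncard_image_of_injective _ hwinj, Set.ncard_univ]
    simp [S, Nat.card_prod]
  let P : Equiv.Perm S := Equiv.ofBijective T (Finite.injective_iff_bijective.1 hTinj)
  have hPT : ∀ (i : ℕ) s, (P ^ i) s = T^[i] s := by
    intro i s
    rw [Equiv.Perm.coe_pow]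
    rfl
  let Q := Quotient (Equiv.Perm.SameCycle.setoid P)
  let E : Q ≃ Fin (Nat.card Q) := Finite.equivFin Q
  let rep : Fin (Nat.card Q) → S := fun s => (E.symm s).out
  let L : Fin (Nat.card Q) → ℕ := fun s => Function.minimalPeriod T (rep s)
  have hLpos : ∀ s, 0 < L s := fun s =>
    Function.minimalPeriod_pos_of_mem_periodicPts (hTinj.mem_periodicPts _)
  let X : (s : Fin (Nat.card Q)) → ZMod (L s) → ZMod q := fun s p => x (rep s) p.val
  have hmod : ∀ s (i : ℕ), T^[((i : ZMod (L s))).val] (rep s) = T^[i] (rep s) := by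
    intro s i
    rw [ZMod.val_natCast, Function.iterate_mod_minimalPeriod_eq]
  have hX : ∀ s (i : ℕ), X s (i : ZMod (L s)) = x (rep s) i := by
    intro s i
    show x (rep s) _ = _
    have h1 := hxadd (rep s) (i : ZMod (L s)).val 0
    have h2 := hxadd (rep s) i 0
    rw [add_zero] at h1 h2
    rw [h1, h2, hmod]
  have hcv : ∀ s (i : ℕ), cycleVertex (n+k) (X s) (i : ZMod (L s)) = word (T^[i] (rep s)) := by
    intro s i
    funext j
    show X s (_ + _) = x _ _
    rw [← Nat.cast_add, hX, hxadd]
  have hcast : ∀ s (p : ZMod (L s)), ∃ i : ℕ, i < L s ∧ (i : ZMod (L s)) = p := by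
    intro s p
    have : NeZero (L s) := ⟨(hLpos s).ne'⟩
    exact ⟨p.val, ZMod.val_lt p, ZMod.natCast_zmod_val p⟩
  have hsame : ∀ s (i : ℕ), P.SameCycle (rep s) (T^[i] (rep s)) := by
    intro s i
    exact ⟨i, by rw [zpow_natCast, hPT]⟩
  refine ⟨Nat.card Q, L, X, ?_, ?_, ?_, ?_, ?_⟩
  · intro s
    have h1 := hT1 (L s) (rep s)
    have h2 : T^[L s] (rep s) = rep s := Function.iterate_minimalPeriod
    rw [h2] at h1
    have h3 : ((L s : ℕ) : ZMod l) = 0 := by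
      simpa using h1.symm
    obtain ⟨r, hr⟩ := (ZMod.natCast_eq_zero_iff _ _).1 h3
    refine ⟨r, ?_, by rw [hr, mul_comm]⟩
    rcases Nat.eq_zero_or_pos r with h | h
    · have := hLpos s
      rw [hr, h] at this
      simp at this
    · exact h
  · intro s p p' hpp
    obtain ⟨i, hi, rfl⟩ := hcast s p
    obtain ⟨i', hi', rfl⟩ := hcast s p'
    rw [hcv, hcv] at hpp
    rw [Function.iterate_injOn_Iio_minimalPeriod hi hi' (hwinj hpp)]
  · intro s s' hss
    rw [Set.disjoint_left]
    rintro v ⟨p, hp⟩ ⟨p', hp'⟩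
    obtain ⟨i, hi, rfl⟩ := hcast s p
    obtain ⟨i', hi', rfl⟩ := hcast s' p'
    rw [hcv] at hp hp'
    have h1 := hwinj (hp.trans hp'.symm)
    apply hss
    have h2 : P.SameCycle (rep s) (rep s') := by
      have := hsame s i
      rw [h1] at this
      exact this.trans (hsame s' i').symm
    have h3 : E.symm s = E.symm s' := by
      rw [← Quotient.out_eq (E.symm s), ← Quotient.out_eq (E.symm s')]
      exact Quotient.sound h2
    exact E.symm.injective h3
  · rw [← hrange]
    ext v
    rw [Set.mem_iUnion]
    constructor
    · rintro ⟨s, p, rfl⟩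
      obtain ⟨i, hi, rfl⟩ := hcast s p
      rw [hcv]
      exact ⟨_, rfl⟩
    · rintro ⟨σ, rfl⟩
      have h1 : P.SameCycle (rep (E (Quotient.mk _ σ))) σ := by
        have : (Quotient.mk (Equiv.Perm.SameCycle.setoid P) (rep (E (Quotient.mk _ σ)))) =
            Quotient.mk _ σ := by
          simp only [rep, Equiv.symm_apply_apply]
          exact Quotient.out_eq _
        exact Quotient.exact this
      obtain ⟨i, -, hi⟩ := h1.exists_pow_eq'
      rw [hPT] at hi
      refine ⟨E (Quotient.mk _ σ), (i : ZMod _), ?_⟩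
      rw [hcv, hi]
  · intro s
    have hphi : ∀ i : ℕ, (T^[((i : ZMod (L s))).val] (rep s)).1 = (rep s).1 + i := by
      intro i
      rw [hmod, hT1]
    refine ⟨fun p => (T^[p.val] (rep s)).1, ?_, ?_, ?_⟩
    · intro p
      obtain ⟨i, hi, rfl⟩ := hcast s p
      have := hphi (i + 1)
      push_cast at this
      simp only [this, hphi]
      ring
    · intro p
      obtain ⟨i, hi, rfl⟩ := hcast s p
      simp only [hphi, ← Nat.cast_add, hX]
      exact hxw _ _
    · intro p
      obtain ⟨i, hi, rfl⟩ := hcast s p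
      rw [hcv, hDw]
      show _ = cycleVertex n c (T^[((i : ZMod (L s))).val] (rep s)).1
      rw [hmod]

end DeBruijn
end

section
/- Let q ≥ 2, n ≥ 2, and α, β ∈ ZMod q with α + β = 0 and β a unit. Let Γ be a De Bruijn cycle of order n−1 (a vertex-disjoint cycle of length q^{n−1} in B_{n−1}(q) visiting every word of (ZMod q)^{n−1}) with symbol sequence γ and weight W(Γ) = 0, and let C be a vertex-disjoint cycle of length q^{n−1} in B_n(q) with symbol sequence x : ZMod q^{n−1} → ZMod q satisfying α·x_i + β·x_{i+1} = γ_i for all i. Then the q translate cycles C + c for c ∈ ZMod q (with symbol sequences i ↦ x_i + c) are vertex-disjoint cycles of length q^{n−1} in B_n(q) whose vertex sets are pairwise disjoint and together partition (ZMod q)^n; in particular every word of (ZMod q)^n lies on exactly one of these q cycles. -/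
namespace DeBruijn

/-- Let `Γ` be a De Bruijn cycle of order `n-1` over `ZMod q` with weight
`0`, and let `C` (symbol sequence `x`) be a vertex-disjoint cycle of length `q^{n-1}` in
`B_n(q)` mapping onto `Γ` under the homomorphism induced by `d(x₁,x₂) = αx₁ + βx₂`
(`α + β = 0`, `β` a unit).  Then the `q` translates `C + c`, `c ∈ ZMod q`, are
vertex-disjoint cycles of length `q^{n-1}` in `B_n(q)` whose vertex sets are pairwise
disjoint and together partition `(ZMod q)^n`. -/
theorem stmt16 (q n : ℕ) (hq : 2 ≤ q) (hn : 2 ≤ n)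
    (α β : ZMod q) (hαβ : α + β = 0) (hβ : IsUnit β)
    (γ : ZMod (q ^ (n - 1)) → ZMod q)
    (hvd : Function.Injective (cycleVertex (n - 1) γ))
    (hall : Function.Surjective (cycleVertex (n - 1) γ))
    (hw : weight (q ^ (n - 1)) γ = 0)
    (x : ZMod (q ^ (n - 1)) → ZMod q)
    (hx : VertexDisjoint n x)
    (himg : ∀ i : ZMod (q ^ (n - 1)), α * x i + β * x (i + 1) = γ i) :
    (∀ c : ZMod q, VertexDisjoint n (fun i => x i + c)) ∧
    (∀ c c' : ZMod q, c ≠ c' →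
      Disjoint (Set.range (cycleVertex n (fun i => x i + c)))
        (Set.range (cycleVertex n (fun i => x i + c')))) ∧
    (⋃ c : ZMod q, Set.range (cycleVertex n (fun i => x i + c))) = Set.univ := by
  have key : ∀ (c c' : ZMod q) (i j : ZMod (q ^ (n - 1))),
      cycleVertex n (fun i => x i + c) i = cycleVertex n (fun i => x i + c') j → i = j := by
    intro c c' i j h
    apply hvd
    funext t
    have h0 := congrFun h ⟨t.1, by omega⟩
    have h1 := congrFun h ⟨t.1 + 1, by omega⟩
    simp only [cycleVertex, Nat.cast_add, Nat.cast_one, ← add_assoc] at h0 h1 ⊢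
    rw [← himg, ← himg]
    linear_combination α * h0 + β * h1 + (c' - c) * hαβ
  refine ⟨fun c i j h => key c c i j h, ?_, ?_⟩
  · intro c c' hc
    rw [Set.disjoint_left]
    rintro _ ⟨i, rfl⟩ ⟨j, hj⟩
    have hij := key _ _ _ _ hj
    subst hij
    have h0 := congrFun hj ⟨0, by omega⟩
    simp only [cycleVertex] at h0
    exact hc (add_left_cancel h0).symm
  · rw [Set.eq_univ_iff_forall]
    intro w
    obtain ⟨i, hi⟩ := hall (fun t : Fin (n - 1) =>
      α * w ⟨t.1, by omega⟩ + β * w ⟨t.1 + 1, by omega⟩)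
    refine Set.mem_iUnion.2 ⟨w ⟨0, by omega⟩ - x i, i, ?_⟩
    have main : ∀ (t : ℕ) (ht : t < n), x (i + (t : ZMod (q ^ (n - 1)))) +
        (w ⟨0, by omega⟩ - x i) = w ⟨t, ht⟩ := by
      intro t
      induction t with
      | zero => intro ht; simp
      | succ t ih =>
        intro ht
        have h0 := ih (by omega)
        have h1 := congrFun hi ⟨t, by omega⟩
        simp only [cycleVertex] at h1
        rw [← himg] at h1
        simp only [Nat.cast_add, Nat.cast_one, ← add_assoc]
        apply hβ.mul_left_cancel
        linear_combination h1 - α * h0 + (w ⟨0, by omega⟩ - x i) * hαβ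
    funext t
    exact main t.1 t.2

end DeBruijn
end
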